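/- arXiv:0904.1097 — 2 statements merged into one kernel-verified Lean document; each statement's English description precedes it below -/
import Mathlib

section
/- For every positive integer n there exists a bijection Φ on the set of set partitions of [n] such that for every set partition 𝓑: op(Φ(𝓑)) = op(𝓑), cl(Φ(𝓑)) = cl(𝓑), the cardinality of a maximal crossing of Φ(𝓑) equals the cardinality of a maximal nesting of 𝓑, and the cardinality of a maximal nesting of Φ(𝓑) equals the cardinality of a maximal crossing of 𝓑. -/
open scoped Classical
noncomputable section

/-! ### Set partitions of type A -/

/-- A set partition of `[n] = {1,…,n}`: pairwise disjoint nonempty blocks covering `[n]`. -/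
structure SetPartitionA (n : ℕ) where
  blocks : Finset (Finset ℕ)
  nonempty : ∀ B ∈ blocks, B.Nonempty
  disj : ∀ B ∈ blocks, ∀ B' ∈ blocks, B ≠ B' → Disjoint B B'
  cover : ∀ i : ℕ, (∃ B ∈ blocks, i ∈ B) ↔ i ∈ Finset.Icc 1 n

/-- Two arcs `(i,j)`, `(i',j')` cross if `i<i'<j<j'` (in either order of the two arcs). -/
def ACross (a b : ℕ × ℕ) : Prop :=
  (a.1 < b.1 ∧ b.1 < a.2 ∧ a.2 < b.2) ∨ (b.1 < a.1 ∧ a.1 < b.2 ∧ b.2 < a.2)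

/-- Two arcs `(i,j)`, `(i',j')` nest if `i<i'<j'<j` (in either order of the two arcs). -/
def ANest (a b : ℕ × ℕ) : Prop :=
  (a.1 < b.1 ∧ b.1 < b.2 ∧ b.2 < a.2) ∨ (b.1 < a.1 ∧ a.1 < a.2 ∧ a.2 < b.2)

namespace SetPartitionA

variable {n : ℕ}

/-- Openers: elements of `[n]` that are not the maximum of their block. -/
def openers (P : SetPartitionA n) : Finset ℕ :=
  (Finset.Icc 1 n).filter fun i => ∃ B ∈ P.blocks, i ∈ B ∧ ∃ j ∈ B, i < j

/-- Closers: elements of `[n]` that are not the minimum of their block. -/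
def closers (P : SetPartitionA n) : Finset ℕ :=
  (Finset.Icc 1 n).filter fun i => ∃ B ∈ P.blocks, i ∈ B ∧ ∃ j ∈ B, j < i

/-- `(i,j)` is an arc: `i < j` are in the same block with no block element in between. -/
def IsArc (P : SetPartitionA n) (i j : ℕ) : Prop :=
  i < j ∧ ∃ B ∈ P.blocks, i ∈ B ∧ j ∈ B ∧ ∀ k ∈ B, ¬(i < k ∧ k < j)

/-- The finite set of arcs of `P`. -/
def arcs (P : SetPartitionA n) : Finset (ℕ × ℕ) :=
  ((Finset.Icc 1 n) ×ˢ (Finset.Icc 1 n)).filter fun p => P.IsArc p.1 p.2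

/-- The number of crossings: pairs of arcs `(i,j)`, `(i',j')` with `i<i'<j<j'`. -/
def crossings (P : SetPartitionA n) : ℕ :=
  ((P.arcs ×ˢ P.arcs).filter fun q =>
    q.1.1 < q.2.1 ∧ q.2.1 < q.1.2 ∧ q.1.2 < q.2.2).card

/-- The number of nestings: pairs of arcs `(i,j)`, `(i',j')` with `i<i'<j'<j`. -/
def nestings (P : SetPartitionA n) : ℕ :=
  ((P.arcs ×ˢ P.arcs).filter fun q =>
    q.1.1 < q.2.1 ∧ q.2.1 < q.2.2 ∧ q.2.2 < q.1.2).card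

/-- The cardinality of a maximal crossing: largest set of mutually crossing arcs. -/
def maxCrossing (P : SetPartitionA n) : ℕ :=
  (P.arcs.powerset.filter fun S => ∀ a ∈ S, ∀ b ∈ S, a ≠ b → ACross a b).sup Finset.card

/-- The cardinality of a maximal nesting: largest set of mutually nesting arcs. -/
def maxNesting (P : SetPartitionA n) : ℕ :=
  (P.arcs.powerset.filter fun S => ∀ a ∈ S, ∀ b ∈ S, a ≠ b → ANest a b).sup Finset.card

end SetPartitionA

/-! ### Set partitions of classical types B/C/D on `[±n]` -/

/-- Position of `i ∈ [±n]` in the type `C` nesting order `1<⋯<n<-n<⋯<-1`. -/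
def nestOrd (n : ℕ) (i : ℤ) : ℤ := if 0 < i then i else 2 * n + 1 + i

/-- Position of `i ∈ [±n]` in the crossing order `1<⋯<n<-1<⋯<-n`. -/
def crossOrd (n : ℕ) (i : ℤ) : ℤ := if 0 < i then i else (n : ℤ) - i

/-- Position of `i ∈ [±n] ∪ {0}` in the type `B` nesting order `1<⋯<n<0<-n<⋯<-1`. -/
def nestOrdB (n : ℕ) (i : ℤ) : ℤ :=
  if 0 < i then i else if i = 0 then (n : ℤ) + 1 else 2 * n + 2 + i

/-- The negative `-B` of a block. -/
def negSet (B : Finset ℤ) : Finset ℤ := B.image fun x => -x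

/-- A set partition of type `B_n`/`C_n`: a set partition of `[±n]` with `B ∈ 𝓑 ↔ -B ∈ 𝓑`
and at most one block `B₀` with `B₀ = -B₀`. -/
structure SetPartitionC (n : ℕ) where
  blocks : Finset (Finset ℤ)
  nonempty : ∀ B ∈ blocks, B.Nonempty
  disj : ∀ B ∈ blocks, ∀ B' ∈ blocks, B ≠ B' → Disjoint B B'
  cover : ∀ i : ℤ, (∃ B ∈ blocks, i ∈ B) ↔ (i ≠ 0 ∧ |i| ≤ (n : ℤ))
  symm : ∀ B ∈ blocks, negSet B ∈ blocks
  zeroBlock : ∀ B ∈ blocks, ∀ B' ∈ blocks, negSet B = B → negSet B' = B' → B = B'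

/-- Endpoints of an arc, ordered by the crossing order. -/
def cpr (n : ℕ) (p : ℤ × ℤ) : ℤ × ℤ :=
  (min (crossOrd n p.1) (crossOrd n p.2), max (crossOrd n p.1) (crossOrd n p.2))

/-- `p` crosses `q` with `p` coming first in the crossing order. -/
def CrossRel (n : ℕ) (p q : ℤ × ℤ) : Prop :=
  (cpr n p).1 < (cpr n q).1 ∧ (cpr n q).1 < (cpr n p).2 ∧ (cpr n p).2 < (cpr n q).2

/-- The two arcs `p`, `q` cross in the crossing diagram. -/
def Crosses (n : ℕ) (p q : ℤ × ℤ) : Prop := CrossRel n p q ∨ CrossRel n q p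

/-- `p` nests over `q` in the nesting diagram (arcs written in nesting order). -/
def NestRel (n : ℕ) (p q : ℤ × ℤ) : Prop :=
  nestOrd n p.1 < nestOrd n q.1 ∧ nestOrd n q.2 < nestOrd n p.2

/-- The two arcs `p`, `q` nest in the nesting diagram. -/
def Nests (n : ℕ) (p q : ℤ × ℤ) : Prop := NestRel n p q ∨ NestRel n q p

/-- `p` nests over `q` in the type `B` nesting diagram. -/
def NestRelB (n : ℕ) (p q : ℤ × ℤ) : Prop :=
  nestOrdB n p.1 < nestOrdB n q.1 ∧ nestOrdB n q.2 < nestOrdB n p.2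

/-- The two arcs `p`, `q` nest in the type `B` nesting diagram. -/
def NestsB (n : ℕ) (p q : ℤ × ℤ) : Prop := NestRelB n p q ∨ NestRelB n q p

/-- Exceptional pairs for type `B` crossings: both arcs have positive opener and negative
closer, and at least one closer is smaller in absolute value than its opener. -/
def ExcCross (p q : ℤ × ℤ) : Prop :=
  0 < p.1 ∧ p.2 < 0 ∧ 0 < q.1 ∧ q.2 < 0 ∧ (|p.2| < |p.1| ∨ |q.2| < |q.1|)

/-- Exceptional pairs for type `B` nestings: both arcs have positive opener (or begin at `0`)
and negative closer (or end at `0`), and at least one closer is smaller in absolute value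
than its opener. -/
def ExcNest (p q : ℤ × ℤ) : Prop :=
  0 ≤ p.1 ∧ p.2 ≤ 0 ∧ 0 ≤ q.1 ∧ q.2 ≤ 0 ∧ (|p.2| < |p.1| ∨ |q.2| < |q.1|)

/-- A block augmented by `0` if it is the zero block. -/
def augB (B : Finset ℤ) : Finset ℤ := if negSet B = B then insert 0 B else B

/-- The arc `p` contains `n`. -/
def ContainsN (n : ℕ) (p : ℤ × ℤ) : Prop := p.1 = (n : ℤ) ∨ p.2 = (n : ℤ)

/-- The arc `p` contains `-n`. -/
def ContainsNegN (n : ℕ) (p : ℤ × ℤ) : Prop := p.1 = -(n : ℤ) ∨ p.2 = -(n : ℤ)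

namespace SetPartitionC

variable {n : ℕ}

/-- The ground set `[±n]` as a finset of integers. -/
def pmn (n : ℕ) : Finset ℤ := (Finset.Icc (-(n : ℤ)) (n : ℤ)).erase 0

/-- `(i,j)` is an arc: `i`, `j` are consecutive elements of a block in the nesting order. -/
def IsArc (P : SetPartitionC n) (i j : ℤ) : Prop :=
  nestOrd n i < nestOrd n j ∧ ∃ B ∈ P.blocks, i ∈ B ∧ j ∈ B ∧
    ∀ k ∈ B, ¬(nestOrd n i < nestOrd n k ∧ nestOrd n k < nestOrd n j)

/-- The finite set of arcs of `P` (written in nesting order). -/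
def arcs (P : SetPartitionC n) : Finset (ℤ × ℤ) :=
  (pmn n ×ˢ pmn n).filter fun p => P.IsArc p.1 p.2

/-- Openers: positive elements that are not maximal in their block w.r.t. the nesting order. -/
def openers (P : SetPartitionC n) : Finset ℤ :=
  (Finset.Icc 1 (n : ℤ)).filter fun i =>
    ∃ B ∈ P.blocks, i ∈ B ∧ ∃ j ∈ B, nestOrd n i < nestOrd n j

/-- Closers: positive elements that are not minimal in their block w.r.t. the nesting order. -/
def closers (P : SetPartitionC n) : Finset ℤ :=
  (Finset.Icc 1 (n : ℤ)).filter fun i =>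
    ∃ B ∈ P.blocks, i ∈ B ∧ ∃ j ∈ B, nestOrd n j < nestOrd n i

/-- The number of crossings of a type `C` set partition. -/
def crossings (P : SetPartitionC n) : ℕ :=
  ((P.arcs ×ˢ P.arcs).filter fun q => CrossRel n q.1 q.2).card

/-- The number of nestings of a type `C` set partition. -/
def nestings (P : SetPartitionC n) : ℕ :=
  ((P.arcs ×ˢ P.arcs).filter fun q => NestRel n q.1 q.2).card

/-- The number of crossings among pairs of arcs that both have positive opener. -/
def crossingsPos (P : SetPartitionC n) : ℕ :=
  (((P.arcs.filter fun p => 0 < p.1) ×ˢ (P.arcs.filter fun p => 0 < p.1)).filter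
    fun q => CrossRel n q.1 q.2).card

/-- The number of nestings among pairs of arcs that both have positive opener. -/
def nestingsPos (P : SetPartitionC n) : ℕ :=
  (((P.arcs.filter fun p => 0 < p.1) ×ˢ (P.arcs.filter fun p => 0 < p.1)).filter
    fun q => NestRel n q.1 q.2).card

/-- The cardinality of a maximal crossing. -/
def maxCrossing (P : SetPartitionC n) : ℕ :=
  (P.arcs.powerset.filter fun S => ∀ a ∈ S, ∀ b ∈ S, a ≠ b → Crosses n a b).sup Finset.card

/-- The cardinality of a maximal nesting. -/
def maxNesting (P : SetPartitionC n) : ℕ :=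
  (P.arcs.powerset.filter fun S => ∀ a ∈ S, ∀ b ∈ S, a ≠ b → Nests n a b).sup Finset.card

/-! ### Type B notions -/

/-- `(i,j)` is a type `B` nesting arc: consecutive elements of an augmented block in the
type `B` nesting order. -/
def IsArcB (P : SetPartitionC n) (i j : ℤ) : Prop :=
  nestOrdB n i < nestOrdB n j ∧ ∃ B ∈ P.blocks, i ∈ augB B ∧ j ∈ augB B ∧
    ∀ k ∈ augB B, ¬(nestOrdB n i < nestOrdB n k ∧ nestOrdB n k < nestOrdB n j)

/-- The finite set of type `B` nesting arcs of `P`. -/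
def arcsB (P : SetPartitionC n) : Finset (ℤ × ℤ) :=
  ((insert 0 (pmn n)) ×ˢ (insert 0 (pmn n))).filter fun p => P.IsArcB p.1 p.2

/-- The number of type `B` crossings. -/
def crossingsB (P : SetPartitionC n) : ℕ :=
  ((P.arcs ×ˢ P.arcs).filter fun q => CrossRel n q.1 q.2 ∧ ¬ExcCross q.1 q.2).card

/-- The number of type `B` nestings. -/
def nestingsB (P : SetPartitionC n) : ℕ :=
  ((P.arcsB ×ˢ P.arcsB).filter fun q => NestRelB n q.1 q.2 ∧ ¬ExcNest q.1 q.2).card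

/-- Openers in type `B`: positive elements not maximal in their block
w.r.t. the type `B` nesting order. -/
def openersB (P : SetPartitionC n) : Finset ℤ :=
  (Finset.Icc 1 (n : ℤ)).filter fun i =>
    ∃ B ∈ P.blocks, i ∈ B ∧ ∃ j ∈ B, nestOrdB n i < nestOrdB n j

/-- Closers in type `B`: positive elements not minimal in their block
w.r.t. the type `B` nesting order. -/
def closersB (P : SetPartitionC n) : Finset ℤ :=
  (Finset.Icc 1 (n : ℤ)).filter fun i =>
    ∃ B ∈ P.blocks, i ∈ B ∧ ∃ j ∈ B, nestOrdB n j < nestOrdB n i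

/-- The cardinality of a maximal type `B` crossing. -/
def maxCrossingB (P : SetPartitionC n) : ℕ :=
  (P.arcs.powerset.filter fun S =>
    ∀ a ∈ S, ∀ b ∈ S, a ≠ b → Crosses n a b ∧ ¬ExcCross a b).sup Finset.card

/-- The cardinality of a maximal type `B` nesting. -/
def maxNestingB (P : SetPartitionC n) : ℕ :=
  (P.arcsB.powerset.filter fun S =>
    ∀ a ∈ S, ∀ b ∈ S, a ≠ b → NestsB n a b ∧ ¬ExcNest a b).sup Finset.card

/-! ### Type D notions -/

/-- A type `C` set partition is of type `D` if the zero block, when present, is not a single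
pair `{i,-i}`. -/
def IsTypeD (P : SetPartitionC n) : Prop :=
  ∀ B ∈ P.blocks, negSet B = B → B.card ≠ 2

/-- The arcs starting in `{1,…,n-1}` and ending in the negative of an element of `{1,…,n-1}`. -/
def pnArcs (P : SetPartitionC n) : Finset (ℤ × ℤ) :=
  P.arcs.filter fun p => 0 < p.1 ∧ p.1 < (n : ℤ) ∧ -(n : ℤ) < p.2 ∧ p.2 < 0

/-- The index `l` of an arc `a = (i_l, -j_l)` in the list of `pnArcs` ordered by openers. -/
def dRank (P : SetPartitionC n) (a : ℤ × ℤ) : ℕ :=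
  (P.pnArcs.filter fun b => b.1 ≤ a.1).card

/-- The crossings allowed in a non-crossing set partition of type `D`. -/
def AllowedCrossD (P : SetPartitionC n) (p q : ℤ × ℤ) : Prop :=
  (ContainsN n p ∧ q ∈ P.pnArcs ∧ P.pnArcs.card < 2 * P.dRank q) ∨
  (ContainsN n q ∧ p ∈ P.pnArcs ∧ P.pnArcs.card < 2 * P.dRank p) ∨
  (ContainsNegN n p ∧ q ∈ P.pnArcs ∧ 2 * P.dRank q ≤ P.pnArcs.card) ∨
  (ContainsNegN n q ∧ p ∈ P.pnArcs ∧ 2 * P.dRank p ≤ P.pnArcs.card) ∨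
  (ContainsN n p ∧ ContainsNegN n q) ∨
  (ContainsN n q ∧ ContainsNegN n p)

/-- `P` is a non-crossing set partition of type `D_n`. -/
def NonCrossingD (P : SetPartitionC n) : Prop :=
  (∀ i : ℤ, 0 < i → P.IsArc i (-i) → i = n) ∧
  (∀ p ∈ P.arcs, ∀ q ∈ P.arcs, Crosses n p q → P.AllowedCrossD p q) ∧
  (∀ p ∈ P.arcs, ContainsN n p →
    ∀ q ∈ P.pnArcs, P.pnArcs.card < 2 * P.dRank q → Crosses n p q) ∧
  (∀ p ∈ P.arcs, ContainsNegN n p →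
    ∀ q ∈ P.pnArcs, 2 * P.dRank q ≤ P.pnArcs.card → Crosses n p q)

/-- The nestings (`p` over `q`) allowed in a non-nesting set partition of type `D`. -/
def AllowedNestD (P : SetPartitionC n) (p q : ℤ × ℤ) : Prop :=
  (0 < p.1 ∧ p.1 < q.1 ∧ q.1 < (n : ℤ) ∧ p.2 = -(n : ℤ) ∧ q.2 = (n : ℤ)) ∨
  (q.1 = (n : ℤ) ∧ q.2 = -(n : ℤ) ∧ 0 < p.1 ∧ p.1 < (n : ℤ) ∧ -(n : ℤ) < p.2 ∧ p.2 < 0 ∧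
    ∃ m : ℤ, 0 < m ∧ m < p.1 ∧ m < -p.2 ∧ P.IsArc m (n : ℤ))

/-- `P` is a non-nesting set partition of type `D_n`. -/
def NonNestingD (P : SetPartitionC n) : Prop :=
  (∀ i : ℤ, 0 < i → P.IsArc i (-i) → i = n) ∧
  (∀ p ∈ P.arcs, ∀ q ∈ P.arcs, NestRel n p q → P.AllowedNestD p q)

end SetPartitionC

/-! ### The staircase polyomino and chains in fillings -/

/-- The cells of the staircase polyomino `P_n`: `(c,r)` with `1 ≤ c ≤ n`, `c ≤ r ≤ 2n-1`. -/
def cellsP (n : ℕ) : Finset (ℕ × ℕ) :=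
  ((Finset.Icc 1 n) ×ˢ (Finset.Icc 1 (2 * n - 1))).filter fun p => p.1 ≤ p.2

/-- The length of the longest north-east chain among a set of (nonzero) cells:
columns strictly increase while rows strictly decrease. -/
def neLen (S : Finset (ℕ × ℕ)) : ℕ :=
  (S.powerset.filter fun T =>
    ∀ a ∈ T, ∀ b ∈ T, a ≠ b →
      (a.1 < b.1 ∧ b.2 < a.2) ∨ (b.1 < a.1 ∧ a.2 < b.2)).sup Finset.card

/-- The length of the longest south-east chain among a set of (nonzero) cells:
columns and rows strictly increase, and the surrounding rectangle lies in the polyomino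
(`a.1 ≤ b.2` for all cells `a`, `b` of the chain). -/
def seLen (S : Finset (ℕ × ℕ)) : ℕ :=
  (S.powerset.filter fun T =>
    (∀ a ∈ T, ∀ b ∈ T, a ≠ b →
      (a.1 < b.1 ∧ a.2 < b.2) ∨ (b.1 < a.1 ∧ b.2 < a.2)) ∧
    ∀ a ∈ T, ∀ b ∈ T, a.1 ≤ b.2).sup Finset.card

namespace SetPartitionC

variable {n : ℕ}

/-- The cells filled with `1` in the nesting filling of the staircase polyomino: rows are
labelled from top to bottom by `2,…,n,-n,…,-1`; the cell in column `i` and row labelled `j`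
is filled iff `(i,j)` is an arc with positive opener `i`. -/
def nestFill (P : SetPartitionC n) : Finset (ℕ × ℕ) :=
  (cellsP n).filter fun c => ∃ j : ℤ, P.IsArc (c.1 : ℤ) j ∧ nestOrd n j = (c.2 : ℤ) + 1

/-- The cells filled with `1` in the crossing filling of the staircase polyomino: rows are
labelled from top to bottom by `2,…,n,-1,…,-n`; the cell in column `i` and row labelled `j`
is filled iff `(i,j)` is an arc with positive opener `i`. -/
def crossFill (P : SetPartitionC n) : Finset (ℕ × ℕ) :=
  (cellsP n).filter fun c => ∃ j : ℤ, P.IsArc (c.1 : ℤ) j ∧ crossOrd n j = (c.2 : ℤ) + 1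

end SetPartitionC

/-! ### Triangulations of the symmetric 2n-gon and symmetric fans of Dyck paths -/

/-- `p` is a diagonal of the `2n`-gon with vertices labelled by `[±n]`, written with its two
(distinct) endpoints in crossing order. -/
def IsDiag (n : ℕ) (p : ℤ × ℤ) : Prop :=
  p.1 ≠ 0 ∧ p.2 ≠ 0 ∧ |p.1| ≤ (n : ℤ) ∧ |p.2| ≤ (n : ℤ) ∧ crossOrd n p.1 < crossOrd n p.2

/-- Normalize a pair so that its endpoints are in crossing order. -/
def normD (n : ℕ) (p : ℤ × ℤ) : ℤ × ℤ :=
  if crossOrd n p.1 < crossOrd n p.2 then p else (p.2, p.1)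

/-- `ω` contains `m` mutually crossing diagonals. -/
def HasMCross (n m : ℕ) (ω : Finset (ℤ × ℤ)) : Prop :=
  ∃ S ⊆ ω, S.card = m ∧ ∀ a ∈ S, ∀ b ∈ S, a ≠ b → Crosses n a b

/-- A type `C_n` `k`-triangulation: a symmetric set of diagonals with no `(k+1)`-crossing,
maximal with this property. -/
def IsTriangC (n k : ℕ) (ω : Finset (ℤ × ℤ)) : Prop :=
  (∀ p ∈ ω, IsDiag n p) ∧
  (∀ p ∈ ω, normD n (-p.1, -p.2) ∈ ω) ∧
  ¬HasMCross n (k + 1) ω ∧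
  ∀ d : ℤ × ℤ, IsDiag n d → d ∉ ω → HasMCross n (k + 1) (insert d ω)

/-- A Dyck path in the staircase polyomino starting at the top cell `(i,i)` of column `i`,
proceeding by unit south or west steps inside `P_n`, and ending on the main diagonal
`r = 2n - c`. -/
def IsDyckPath (n i : ℕ) (l : List (ℕ × ℕ)) : Prop :=
  l ≠ [] ∧ l.head? = some (i, i) ∧ (∀ c ∈ l, c ∈ cellsP n) ∧
  l.Chain' (fun a b => (b.1 = a.1 ∧ b.2 = a.2 + 1) ∨ (b.1 + 1 = a.1 ∧ b.2 = a.2)) ∧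
  ∀ c : ℕ × ℕ, l.getLast? = some c → c.2 = 2 * n - c.1

/-- A symmetric fan of `k` non-intersecting Dyck paths: the `i`-th path starts at cell
`(i,i)` and the paths are pairwise cell-disjoint. -/
def IsSymFan (n k : ℕ) (f : Fin k → List (ℕ × ℕ)) : Prop :=
  (∀ i : Fin k, IsDyckPath n ((i : ℕ) + 1) (f i)) ∧
  ∀ i j : Fin k, i ≠ j → ∀ c ∈ f i, c ∉ f j

namespace GD

/-- local rule: (top, right) from bottom, left, filling -/
def rule (b l : ℕ) (x : Prop) : ℕ × ℕ :=
  if x then (1, 1) else if b = l ∧ b ≠ 0 then (b + 1, b + 1) else (b, l)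

def colh (x : ℕ → Prop) (v : ℕ → ℕ) : ℕ → ℕ
  | 0 => 0
  | y + 1 => (rule (colh x v y) (v y) (x y)).1

def V (X : ℕ → ℕ → Prop) : ℕ → ℕ → ℕ
  | 0 => fun _ => 0
  | t + 1 => fun y => (rule (colh (X t) (V X t) y) (V X t y) (X t y)).2

def H (X : ℕ → ℕ → Prop) (t y : ℕ) : ℕ := colh (X t) (V X t) y

theorem H_zero (X : ℕ → ℕ → Prop) (t : ℕ) : H X t 0 = 0 := rfl
theorem V_zero (X : ℕ → ℕ → Prop) (y : ℕ) : V X 0 y = 0 := rfl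
theorem H_succ (X : ℕ → ℕ → Prop) (t y : ℕ) :
    H X t (y + 1) = (rule (H X t y) (V X t y) (X t y)).1 := rfl
theorem V_succ (X : ℕ → ℕ → Prop) (t y : ℕ) :
    V X (t + 1) y = (rule (H X t y) (V X t y) (X t y)).2 := rfl

def Good (X : ℕ → ℕ → Prop) : Prop := ∀ t y, X t y → H X t y = 0 ∧ V X t y = 0

theorem rule_cases (b l : ℕ) (x : Prop) :
    (x ∧ rule b l x = (1, 1)) ∨ (¬ x ∧ b = l ∧ b ≠ 0 ∧ rule b l x = (b + 1, b + 1)) ∨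
    (¬ x ∧ (b ≠ l ∨ (b = 0 ∧ l = 0)) ∧ rule b l x = (b, l)) := by
  unfold rule
  by_cases hx : x
  · simp [hx]
  · by_cases h : b = l ∧ b ≠ 0
    · right; left
      rw [if_neg hx, if_pos h]
      exact ⟨hx, h.1, h.2, rfl⟩
    · right; right
      rw [if_neg hx, if_neg h]
      exact ⟨hx, by omega, rfl⟩

/-- cell case analysis -/
theorem cell_cases (X : ℕ → ℕ → Prop) (hX : Good X) (t y : ℕ) :
    (X t y ∧ H X t y = 0 ∧ V X t y = 0 ∧ H X t (y + 1) = 1 ∧ V X (t + 1) y = 1) ∨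
    (¬ X t y ∧ H X t y = V X t y ∧ H X t y ≠ 0 ∧ H X t (y + 1) = H X t y + 1 ∧
      V X (t + 1) y = H X t y + 1) ∨
    (¬ X t y ∧ (H X t y ≠ V X t y ∨ (H X t y = 0 ∧ V X t y = 0)) ∧ H X t (y + 1) = H X t y ∧
      V X (t + 1) y = V X t y) := by
  rw [H_succ, V_succ]
  rcases rule_cases (H X t y) (V X t y) (X t y) with h | h | h
  · left; have := hX t y h.1; rw [h.2]; exact ⟨h.1, this.1, this.2, rfl, rfl⟩
  · right; left; obtain ⟨h1, h2, h3, h4⟩ := h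
    refine ⟨h1, h2, h3, ?_, ?_⟩ <;> rw [h4]
  · right; right; obtain ⟨h1, h2, h3⟩ := h
    refine ⟨h1, h2, ?_, ?_⟩ <;> rw [h3]

theorem H_ne_zero (X : ℕ → ℕ → Prop) (t y : ℕ) : H X t y ≠ 0 ↔ ∃ z < y, X t z := by
  induction y with
  | zero => simp [H_zero]
  | succ y ih =>
    have : (∃ z < y + 1, X t z) ↔ (∃ z < y, X t z) ∨ X t y := by
      constructor
      · rintro ⟨z, hz, h⟩
        rcases Nat.lt_succ_iff_lt_or_eq.1 hz with h' | h'
        · exact Or.inl ⟨z, h', h⟩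
        · subst h'; exact Or.inr h
      · rintro (⟨z, hz, h⟩ | h)
        · exact ⟨z, by omega, h⟩
        · exact ⟨y, by omega, h⟩
    rw [this, ← ih, H_succ]
    rcases rule_cases (H X t y) (V X t y) (X t y) with h | h | h
    · rw [h.2]; simp [h.1]
    · rw [h.2.2.2]; simp [h.2.2.1]
    · rw [h.2.2]; simp [h.1]

theorem V_ne_zero (X : ℕ → ℕ → Prop) (t y : ℕ) : V X t y ≠ 0 ↔ ∃ s < t, X s y := by
  induction t with
  | zero => simp [V_zero]
  | succ t ih =>
    have : (∃ z < t + 1, X z y) ↔ (∃ z < t, X z y) ∨ X t y := by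
      constructor
      · rintro ⟨z, hz, h⟩
        rcases Nat.lt_succ_iff_lt_or_eq.1 hz with h' | h'
        · exact Or.inl ⟨z, h', h⟩
        · subst h'; exact Or.inr h
      · rintro (⟨z, hz, h⟩ | h)
        · exact ⟨z, by omega, h⟩
        · exact ⟨t, by omega, h⟩
    rw [this, ← ih, V_succ]
    rcases rule_cases (H X t y) (V X t y) (X t y) with h | h | h
    · rw [h.2]; simp [h.1]
    · have h3 := h.2.2.1
      rw [h.2.1] at h3
      rw [h.2.2.2]; simp [h3]
    · rw [h.2.2]; simp [h.1]

theorem good_of_inj (X : ℕ → ℕ → Prop) (h1 : ∀ t y z, X t y → X t z → y = z)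
    (h2 : ∀ s t y, X s y → X t y → s = t) : Good X := by
  intro t y h
  constructor
  · by_contra hc
    obtain ⟨z, hz, h'⟩ := (H_ne_zero X t y).1 hc
    have := h1 _ _ _ h h'; omega
  · by_contra hc
    obtain ⟨z, hz, h'⟩ := (V_ne_zero X t y).1 hc
    have := h2 _ _ _ h h'; omega

theorem Good.inj1 {X : ℕ → ℕ → Prop} (hX : Good X) {t y z : ℕ} (h : X t y) (h' : X t z) :
    y = z := by
  rcases lt_trichotomy y z with hl | hl | hl
  · exact absurd (hX _ _ h').1 ((H_ne_zero X t z).2 ⟨y, hl, h⟩)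
  · exact hl
  · exact absurd (hX _ _ h).1 ((H_ne_zero X t y).2 ⟨z, hl, h'⟩)

theorem Good.inj2 {X : ℕ → ℕ → Prop} (hX : Good X) {s t y : ℕ} (h : X s y) (h' : X t y) :
    s = t := by
  rcases lt_trichotomy s t with hl | hl | hl
  · exact absurd (hX _ _ h').2 ((V_ne_zero X t y).2 ⟨s, hl, h⟩)
  · exact hl
  · exact absurd (hX _ _ h).2 ((V_ne_zero X s y).2 ⟨t, hl, h'⟩)

/-! shapes -/
def ind (l k : ℕ) : ℕ := if l = k + 1 then 1 else 0

def S (X : ℕ → ℕ → Prop) : ℕ → ℕ → ℕ → ℕ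
  | 0 => fun _ _ => 0
  | t + 1 => fun y k => S X t y k + ind (H X t y) k

theorem S_h (X : ℕ → ℕ → Prop) (t y k : ℕ) : S X (t + 1) y k = S X t y k + ind (H X t y) k := rfl
theorem S_0 (X : ℕ → ℕ → Prop) (y k : ℕ) : S X 0 y k = 0 := rfl
theorem S_y0 (X : ℕ → ℕ → Prop) (t k : ℕ) : S X t 0 k = 0 := by
  induction t with
  | zero => rfl
  | succ t ih => rw [S_h, ih, H_zero]; simp [ind]

theorem S_v (X : ℕ → ℕ → Prop) (hX : Good X) (t y k : ℕ) :
    S X t (y + 1) k = S X t y k + ind (V X t y) k := by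
  induction t with
  | zero => simp [S_0, V_zero, ind]
  | succ t ih =>
    rw [S_h, S_h, ih]
    rcases cell_cases X hX t y with ⟨_, a, b, c, d⟩ | ⟨_, a, b, c, d⟩ | ⟨_, a, c, d⟩
    · rw [a, b, c, d]
    · rw [← a, c, d]; 
    · rw [c, d]
      first | done | omega

theorem S_mono_t (X : ℕ → ℕ → Prop) {t t' : ℕ} (h : t ≤ t') (y k : ℕ) : S X t y k ≤ S X t' y k := by
  induction t', h using Nat.le_induction with
  | base => exact le_rfl
  | succ m _ ih => rw [S_h]; omega

theorem S_mono_y (X : ℕ → ℕ → Prop) (hX : Good X) {y y' : ℕ} (h : y ≤ y') (t k : ℕ) :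
    S X t y k ≤ S X t y' k := by
  induction y', h using Nat.le_induction with
  | base => exact le_rfl
  | succ m _ ih => rw [S_v X hX]; omega

theorem S_anti (X : ℕ → ℕ → Prop) (hX : Good X) (t y k : ℕ) : S X t y (k + 1) ≤ S X t y k := by
  induction t generalizing y k with
  | zero => simp [S_0]
  | succ t iht =>
    induction y generalizing k with
    | zero => simp [S_y0]
    | succ y ihy =>
      have e1 := iht y
      have e2 := iht (y + 1)
      have e3 := ihy
      simp only [S_h, S_v X hX] at *
      have e1 := e1 k
      have e2 := e2 k
      have e3 := e3 k
      rcases cell_cases X hX t y with ⟨_, a, b, c, d⟩ | ⟨_, a, b, c, d⟩ | ⟨_, a, c, d⟩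
      · simp only [a, b, c, ind] at *
        split_ifs at * <;> omega
      · simp only [a, b, c, ind] at *
        split_ifs at * <;> omega
      · simp only [c, ind] at *
        split_ifs at * <;> omega

theorem S_fin (X : ℕ → ℕ → Prop) (t y : ℕ) : ∃ N, ∀ k, N ≤ k → S X t y k = 0 := by
  induction t with
  | zero => exact ⟨0, fun _ _ => rfl⟩
  | succ t ih =>
    obtain ⟨N, hN⟩ := ih
    refine ⟨N + H X t y, fun k hk => ?_⟩
    rw [S_h, hN k (by omega)]
    simp [ind]; omega

/-! shapes: abstract -/
def IsSh (f : ℕ → ℕ) : Prop := (∀ k, f (k + 1) ≤ f k) ∧ ∃ N, ∀ k, N ≤ k → f k = 0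

theorem S_sh (X : ℕ → ℕ → Prop) (hX : Good X) (t y : ℕ) : IsSh (S X t y) :=
  ⟨S_anti X hX t y, S_fin X t y⟩

def conj (f : ℕ → ℕ) (j : ℕ) : ℕ := sInf {i | f i ≤ j}

theorem IsSh.anti {f : ℕ → ℕ} (hf : IsSh f) : Antitone f := antitone_nat_of_succ_le hf.1

theorem lt_conj {f : ℕ → ℕ} (hf : IsSh f) (i j : ℕ) : i < conj f j ↔ j < f i := by
  obtain ⟨N, hN⟩ := hf.2
  have hne : {i | f i ≤ j}.Nonempty := ⟨N, by simp [hN N le_rfl]⟩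
  constructor
  · intro h
    have := Nat.notMem_of_lt_sInf h
    simpa using this
  · intro h
    by_contra hc
    have h1 : f (conj f j) ≤ j := Nat.sInf_mem hne
    have := hf.anti (not_lt.1 hc)
    omega

theorem conj_sh {f : ℕ → ℕ} (hf : IsSh f) : IsSh (conj f) := by
  constructor
  · intro k
    by_contra hc
    have := (lt_conj hf _ _).1 (not_le.1 hc)
    have h2 := (lt_conj hf (conj f k) k).2 (by omega)
    omega
  · refine ⟨f 0, fun k hk => ?_⟩
    by_contra hc
    have := (lt_conj hf 0 k).1 (by omega)
    omega

theorem conj_conj {f : ℕ → ℕ} (hf : IsSh f) : conj (conj f) = f := by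
  funext i
  apply le_antisymm
  · by_contra hc
    have := (lt_conj (conj_sh hf) _ _).1 (not_le.1 hc)
    have := (lt_conj hf _ _).1 this
    omega
  · by_contra hc
    have := (lt_conj hf _ _).2 (not_le.1 hc)
    have := (lt_conj (conj_sh hf) _ _).2 this
    omega

def Step (f : ℕ → ℕ) (l : ℕ) (g : ℕ → ℕ) : Prop := ∀ k, g k = f k + ind l k

theorem Step.uniq {f g : ℕ → ℕ} {l l' : ℕ} (h : Step f l g) (h' : Step f l' g) : l = l' := by
  have key : ∀ k, ind l k = ind l' k := fun k => by have := h k; have := h' k; omega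
  rcases l with _ | l
  · rcases l' with _ | l'
    · rfl
    · have := key l'; simp [ind] at this
  · have := key l
    by_contra hc
    simp only [ind, if_true] at this
    rw [if_neg (fun h => hc h.symm)] at this
    omega

theorem Step.conj_step {f g : ℕ → ℕ} {l : ℕ} (hf : IsSh f) (hg : IsSh g) (h : Step f l g) :
    ∃ l', Step (conj f) l' (conj g) ∧ (l' = 0 ↔ l = 0) := by
  rcases l with _ | k
  · refine ⟨0, ?_, by simp⟩
    have : g = f := funext fun i => by have := h i; simpa [ind] using this
    intro i; simp [this, ind]
  · refine ⟨f k + 1, ?_, by simp⟩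
    intro j
    have hk := h k
    simp only [ind, if_true] at hk
    by_cases hj : j = f k
    · subst hj
      have a1 : k < conj g (f k) := (lt_conj hg _ _).2 (by omega)
      have a2 : ¬ k < conj f (f k) := fun h => by have := (lt_conj hf _ _).1 h; omega
      have a3 : ¬ k + 1 < conj g (f k) := fun h' => by
        have h2 := (lt_conj hg _ _).1 h'
        have := h (k+1)
        have h3 := hf.1 k
        simp [ind] at this; omega
      have a4 : k ≤ conj f (f k) := by
        rcases k with _ | k
        · omega
        · apply (lt_conj hf _ _).2
          have := h k
          have h3 := hg.1 k
          simp [ind] at this; omega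
      simp only [ind, if_true]; omega
    · have hind : ind (f k + 1) j = 0 := by simp [ind]; omega
      rw [hind, Nat.add_zero]
      have key : ∀ i, i < conj g j ↔ i < conj f j := by
        intro i
        rw [lt_conj hg, lt_conj hf]
        have := h i
        by_cases hi : i = k
        · subst hi; omega
        · have : ind (k + 1) i = 0 := by simp [ind]; omega
          omega
      apply le_antisymm
      · by_contra hc
        have := (key _).1 (not_le.1 hc); omega
      · by_contra hc
        have := (key _).2 (not_le.1 hc); omega

end GD

namespace GD

/-! chains -/
def C (p : ℕ → ℕ → Prop) (Y : ℕ) : ℕ → ℕ → ℕ → Prop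
  | 0 => fun _ _ => True
  | d + 1 => fun T y0 => ∃ t y, t < T ∧ y0 ≤ y ∧ y < Y ∧ p t y ∧ C p Y d t (y + 1)

def I (p : ℕ → ℕ → Prop) : ℕ → ℕ → ℕ → Prop
  | 0 => fun _ _ => True
  | d + 1 => fun T Y => ∃ t y, t < T ∧ y < Y ∧ p t y ∧ I p d t y

theorem C_mono {p : ℕ → ℕ → Prop} {Y d T T' y y' : ℕ} (hT : T ≤ T') (hy : y' ≤ y)
    (h : C p Y d T y) : C p Y d T' y' := by
  cases d with
  | zero => trivial
  | succ d =>
    obtain ⟨t, z, h1, h2, h3⟩ := h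
    exact ⟨t, z, by omega, by omega, h3⟩

theorem I_mono {p : ℕ → ℕ → Prop} {Y d T T' Y' : ℕ} (hT : T ≤ T') (hy : Y ≤ Y')
    (h : I p d T Y) : I p d T' Y' := by
  cases d with
  | zero => trivial
  | succ d =>
    obtain ⟨t, z, h1, h2, h3⟩ := h
    exact ⟨t, z, by omega, by omega, h3⟩

structure Lev (h v p q : ℕ → ℕ → Prop) : Prop where
  h0 : ∀ t, ¬ h t 0
  v0 : ∀ y, ¬ v 0 y
  hq : ∀ t y, q t y ↔ h t y ∧ v t y
  hs : ∀ t y, h t (y + 1) ↔ p t y ∨ (h t y ∧ ¬ q t y)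
  vs : ∀ t y, v (t + 1) y ↔ p t y ∨ (v t y ∧ ¬ q t y)

namespace Lev
variable {h v p q : ℕ → ℕ → Prop}

theorem betweenA (L : Lev h v p q) {t y t' y' : ℕ} (a : p t y) (b : p t' y') (ht : t < t')
    (hy : y' < y) : ∃ s z, t < s ∧ s ≤ t' ∧ y' < z ∧ z ≤ y ∧ q s z := by
  by_contra hc
  push Not at hc
  have e1 : ∀ s, t + 1 ≤ s → s ≤ t' → v s y := by
    intro s hs
    induction s, hs using Nat.le_induction with
    | base => intro _; exact (L.vs _ _).2 (Or.inl a)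
    | succ m hm ih =>
      intro hm'
      exact (L.vs _ _).2 (Or.inr ⟨ih (by omega), hc m y (by omega) (by omega) hy le_rfl⟩)
  have e2 : ∀ z, y' + 1 ≤ z → z ≤ y → h t' z := by
    intro s hs
    induction s, hs using Nat.le_induction with
    | base => intro _; exact (L.hs _ _).2 (Or.inl b)
    | succ m hm ih =>
      intro hm'
      exact (L.hs _ _).2 (Or.inr ⟨ih (by omega), hc t' m ht le_rfl (by omega) (by omega)⟩)
  exact hc t' y ht le_rfl hy le_rfl ((L.hq _ _).2 ⟨e2 y hy le_rfl, e1 t' ht le_rfl⟩)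

theorem betweenB (L : Lev h v p q) {t y t' y' : ℕ} (a : q t y) (b : q t' y') (ht : t < t')
    (hy : y' < y) : ∃ s z, t ≤ s ∧ s < t' ∧ y' ≤ z ∧ z < y ∧ p s z := by
  by_contra hc
  push Not at hc
  have a' := ((L.hq _ _).1 a).1
  have b' := ((L.hq _ _).1 b).2
  have e1 : ∀ k, k ≤ t' → t ≤ t' - k → v (t' - k) y' := by
    intro k
    induction k with
    | zero => intro _ _; exact b'
    | succ k ih =>
      intro h1 h2
      have := ih (by omega) (by omega)
      have e : t' - k = (t' - (k + 1)) + 1 := by omega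
      rw [e] at this
      rcases (L.vs _ _).1 this with h3 | h3
      · exact absurd h3 (hc _ _ (by omega) (by omega) le_rfl hy)
      · exact h3.1
  have e2 : ∀ k, k ≤ y → y' ≤ y - k → h t (y - k) := by
    intro k
    induction k with
    | zero => intro _ _; exact a'
    | succ k ih =>
      intro h1 h2
      have := ih (by omega) (by omega)
      have e : y - k = (y - (k + 1)) + 1 := by omega
      rw [e] at this
      rcases (L.hs _ _).1 this with h3 | h3
      · exact absurd h3 (hc _ _ le_rfl ht h2 (by omega))
      · exact h3.1
  have f1 := e1 (t' - (t + 1)) (by omega) (by omega)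
  have f2 := e2 (y - y') (by omega) (by omega)
  rw [show t' - (t' - (t + 1)) = t + 1 by omega] at f1
  rw [show y - (y - y') = y' by omega] at f2
  rcases (L.vs _ _).1 f1 with h3 | h3
  · exact hc _ _ le_rfl ht le_rfl hy h3
  · exact h3.2 ((L.hq _ _).2 ⟨f2, h3.1⟩)

theorem exV (L : Lev h v p q) {t y : ℕ} (a : v t y) : ∃ s < t, p s y := by
  induction t with
  | zero => exact absurd a (L.v0 _)
  | succ t ih =>
    rcases (L.vs _ _).1 a with h3 | h3
    · exact ⟨t, by omega, h3⟩
    · obtain ⟨s, hs, h4⟩ := ih h3.1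
      exact ⟨s, by omega, h4⟩

theorem exH (L : Lev h v p q) {t y : ℕ} (a : h t y) : ∃ z < y, p t z := by
  induction y with
  | zero => exact absurd a (L.h0 _)
  | succ t ih =>
    rcases (L.hs _ _).1 a with h3 | h3
    · exact ⟨t, by omega, h3⟩
    · obtain ⟨s, hs, h4⟩ := ih h3.1
      exact ⟨s, by omega, h4⟩

theorem chainA (L : Lev h v p q) (Y d : ℕ) : ∀ t y, p t y → C p Y d t (y + 1) →
    C q Y d (t + 1) (y + 1) := by
  induction d with
  | zero => intros; trivial
  | succ d ih =>
    rintro t y a ⟨t2, y2, h1, h2, h3, h4, h5⟩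
    obtain ⟨s, z, g1, g2, g3, g4, g5⟩ := L.betweenA h4 a h1 h2
    exact ⟨s, z, by omega, by omega, by omega, g5, C_mono (by omega) (by omega) (ih _ _ h4 h5)⟩

theorem chainB (L : Lev h v p q) (Y d : ℕ) : ∀ t y, y < Y → q t y → C q Y d t (y + 1) →
    C p Y (d + 1) t y := by
  induction d with
  | zero =>
    intro t y hy a _
    obtain ⟨s, hs, h1⟩ := L.exV ((L.hq _ _).1 a).2
    exact ⟨s, y, hs, le_rfl, hy, h1, trivial⟩
  | succ d ih =>
    rintro t y hy a ⟨t2, y2, h1, h2, h3, h4, h5⟩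
    obtain ⟨s, z, g1, g2, g3, g4, g5⟩ := L.betweenB h4 a h1 h2
    exact ⟨s, z, by omega, by omega, by omega, g5, C_mono (by omega) (by omega) (ih _ _ h3 h4 h5)⟩

theorem chain_iff (L : Lev h v p q) (Y d T : ℕ) : C p Y (d + 2) T 0 ↔ C q Y (d + 1) T 0 := by
  constructor
  · rintro ⟨t, y, h1, h2, h3, h4, h5⟩
    exact C_mono (by omega) (by omega) (L.chainA Y (d + 1) t y h4 h5)
  · rintro ⟨t, y, h1, h2, h3, h4, h5⟩
    obtain ⟨z, hz, h6⟩ := L.exH ((L.hq _ _).1 h4).1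
    exact ⟨t, z, h1, by omega, by omega, h6, C_mono le_rfl (by omega) (L.chainB Y d t y h3 h4 h5)⟩

end Lev

def K (X : ℕ → ℕ → Prop) : ℕ → ℕ → ℕ → Prop
  | 0 => X
  | k + 1 => fun t y => H X t y = k + 1 ∧ V X t y = k + 1

theorem lev (X : ℕ → ℕ → Prop) (hX : Good X) (k : ℕ) :
    Lev (fun t y => H X t y = k + 1) (fun t y => V X t y = k + 1) (K X k) (K X (k + 1)) where
  h0 t := by simp [H_zero]
  v0 t := by simp [V_zero]
  hq t y := Iff.rfl
  hs t y := by
    cases k <;> simp only [K] <;>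
    rcases cell_cases X hX t y with ⟨e, a, b, c, d⟩ | ⟨e, a, b, c, d⟩ | ⟨e, a, c, d⟩ <;>
    (try simp only [e, true_or, false_or, iff_true]) <;> omega
  vs t y := by
    cases k <;> simp only [K] <;>
    rcases cell_cases X hX t y with ⟨e, a, b, c, d⟩ | ⟨e, a, b, c, d⟩ | ⟨e, a, c, d⟩ <;>
    (try simp only [e, true_or, false_or, iff_true]) <;> omega

theorem S_pos (X : ℕ → ℕ → Prop) (hX : Good X) (k T Y : ℕ) :
    0 < S X T Y k ↔ C (K X k) Y 1 T 0 := by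
  constructor
  · intro h
    have : ∃ t < T, H X t Y = k + 1 := by
      induction T with
      | zero => simp [S_0] at h
      | succ T ih =>
        rw [S_h] at h
        by_cases hh : H X T Y = k + 1
        · exact ⟨T, by omega, hh⟩
        · have : ind (H X T Y) k = 0 := by simp [ind, hh]
          obtain ⟨t, ht, h2⟩ := ih (by omega)
          exact ⟨t, by omega, h2⟩
    obtain ⟨t, ht, h2⟩ := this
    obtain ⟨z, hz, h3⟩ := (lev X hX k).exH h2
    exact ⟨t, z, ht, by omega, hz, h3, trivial⟩
  · rintro ⟨t, y, h1, h2, h3, h4, _⟩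
    have h5 : H X t (y + 1) = k + 1 := ((lev X hX k).hs t y).2 (Or.inl h4)
    have h6 := S_h X t (y + 1) k
    rw [h5] at h6
    simp only [ind, if_true] at h6
    have h7 := S_mono_t X (show t + 1 ≤ T from h1) (y + 1) k
    have h8 := S_mono_y X hX (show y + 1 ≤ Y from h3) T k
    omega

theorem C_K (X : ℕ → ℕ → Prop) (hX : Good X) (T Y d : ℕ) : ∀ k,
    C (K X k) Y (d + 1) T 0 ↔ C (K X (k + d)) Y 1 T 0 := by
  induction d with
  | zero => intro k; rfl
  | succ d ih =>
    intro k
    rw [(lev X hX k).chain_iff, ih (k + 1)]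
    rw [show k + 1 + d = k + (d + 1) by omega]

theorem dec_iff (X : ℕ → ℕ → Prop) (hX : Good X) (T Y k : ℕ) :
    C X Y k T 0 ↔ k ≤ conj (S X T Y) 0 := by
  cases k with
  | zero => simp [C]
  | succ d =>
    have := C_K X hX T Y d 0
    rw [show K X 0 = X from rfl] at this
    rw [this, Nat.zero_add, ← S_pos X hX, ← lt_conj (S_sh X hX T Y)]
    exact Iff.rfl

theorem inc_iff (X : ℕ → ℕ → Prop) (hX : Good X) (T Y k : ℕ) :
    I X k T Y ↔ k ≤ S X T Y 0 := by
  constructor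
  · induction k generalizing T Y with
    | zero => simp
    | succ k ih =>
      rintro ⟨t, y, h1, h2, h3, h4⟩
      have := ih _ _ h4
      have h5 : H X t (y + 1) = 1 := ((lev X hX 0).hs t y).2 (Or.inl h3)
      have h6 := S_h X t (y + 1) 0
      rw [h5] at h6
      simp only [ind, if_true, Nat.zero_add] at h6
      have h7 := S_mono_t X (show t + 1 ≤ T from h1) (y + 1) 0
      have h8 := S_mono_y X hX (show y + 1 ≤ Y from h2) T 0
      have h9 := S_mono_y X hX (show y ≤ y + 1 by omega) t 0
      omega
  · induction T generalizing Y k with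
    | zero => rw [S_0]; intro h; obtain rfl : k = 0 := by omega
              trivial
    | succ T ihT =>
      induction Y generalizing k with
      | zero => rw [S_y0]; intro h; obtain rfl : k = 0 := by omega
                trivial
      | succ Y ihY =>
        intro h
        by_cases h1 : H X T (Y + 1) = 1
        · by_cases h2 : V X (T + 1) Y = 1
          · rcases cell_cases X hX T Y with ⟨e, a, b, c, d⟩ | ⟨e, a, b, c, d⟩ | ⟨e, a, c, d⟩
            · cases k with
              | zero => trivial
              | succ k =>
                refine ⟨T, Y, by omega, by omega, e, ihT Y k ?_⟩
                rw [S_h, S_v X hX, b, c] at h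
                simp only [ind] at h
                simp at h
                exact h
            · omega
            · omega
          · rw [S_v X hX] at h
            have : ind (V X (T + 1) Y) 0 = 0 := by simp [ind, h2]
            rw [this] at h
            exact I_mono le_rfl (by omega) (ihY k h)
        · rw [S_h] at h
          have : ind (H X T (Y + 1)) 0 = 0 := by simp [ind, h1]
          rw [this] at h
          exact I_mono (by omega) le_rfl (ihT _ k h)

/-! inverse -/
theorem H_V_congr {X X' : ℕ → ℕ → Prop} (m : ℕ) (hh : ∀ t y, t + y < m → (X t y ↔ X' t y)) :
    ∀ s t y, t + y = s → s ≤ m → H X t y = H X' t y ∧ V X t y = V X' t y := by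
  intro s
  induction s with
  | zero =>
    intro t y h _
    obtain rfl : t = 0 := by omega
    obtain rfl : y = 0 := by omega
    exact ⟨rfl, rfl⟩
  | succ s ih =>
    intro t y h hs
    constructor
    · cases y with
      | zero => rfl
      | succ y =>
        rw [H_succ, H_succ, (ih t y (by omega) (by omega)).1, (ih t y (by omega) (by omega)).2,
          hh t y (by omega)]
    · cases t with
      | zero => rfl
      | succ t =>
        rw [V_succ, V_succ, (ih t y (by omega) (by omega)).1, (ih t y (by omega) (by omega)).2,
          hh t y (by omega)]

theorem inj_aux {X X' : ℕ → ℕ → Prop} (hX : Good X) (hX' : Good X') (m : ℕ)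
    (hb : ∀ t y, t + y + 1 = m → H X t y = H X' t y ∧ V X t y = V X' t y) :
    ∀ s t y, t + y + 1 + s = m → (H X t y = H X' t y ∧ V X t y = V X' t y) ∧
      (0 < s → (X t y ↔ X' t y)) := by
  intro s
  induction s with
  | zero => intro t y h; exact ⟨hb t y h, by omega⟩
  | succ s ih =>
    intro t y h
    have e1 := (ih t (y + 1) (by omega)).1.1
    have e2 := (ih (t + 1) y (by omega)).1.2
    rcases cell_cases X hX t y with ⟨e, a, b, c, d⟩ | ⟨e, a, b, c, d⟩ | ⟨e, a, c, d⟩ <;>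
    rcases cell_cases X' hX' t y with ⟨e', a', b', c', d'⟩ | ⟨e', a', b', c', d'⟩ | ⟨e', a', c', d'⟩ <;>
    first
    | exact ⟨by omega, fun _ => iff_of_true e e'⟩
    | exact ⟨by omega, fun _ => iff_of_false e e'⟩
    | (exfalso; omega)

/-- inverse local rule on shapes -/
theorem inv_cell {μ ν lam : ℕ → ℕ} {tp r : ℕ} (hμ : IsSh μ) (hν : IsSh ν) (hl : IsSh lam)
    (h1 : Step μ tp lam) (h2 : Step ν r lam) :
    ∃ (ρ : ℕ → ℕ) (b l : ℕ) (x : Prop), IsSh ρ ∧ Step ρ l μ ∧ Step ρ b ν ∧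
      rule b l x = (tp, r) ∧ (x → b = 0 ∧ l = 0) := by
  by_cases hc : tp = r ∧ tp ≠ 0
  · obtain ⟨rfl, h0⟩ := hc
    have hmn : ν = μ := funext fun k => by have := h1 k; have := h2 k; omega
    subst hmn
    by_cases h1' : tp = 1
    · refine ⟨ν, 0, 0, True, hν, fun k => by simp [ind], fun k => by simp [ind], ?_, by simp⟩
      simp [rule, h1']
    · obtain ⟨k, rfl⟩ : ∃ k, tp = k + 2 := ⟨tp - 2, by omega⟩
      have hk := h1 (k + 1)
      have hk0 := h1 k
      have hl1 := hl.1 k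
      simp [ind] at hk hk0
      have hst : Step (fun i => ν i - ind (k + 1) i) (k + 1) ν := by
        intro i
        by_cases hi : i = k
        · subst hi; simp [ind]; omega
        · have : ind (k + 1) i = 0 := by simp [ind]; omega
          simp [this]
      refine ⟨fun i => ν i - ind (k + 1) i, k + 1, k + 1, False, ⟨?_, ?_⟩, hst, hst, ?_, by simp⟩
      · intro i
        have := hν.1 i
        by_cases hi : i = k
        · subst hi; simp [ind]; omega
        · have : ind (k + 1) i = 0 := by simp [ind]; omega
          simp only [this]; omega
      · obtain ⟨N, hN⟩ := hν.2
        exact ⟨N, fun i hi => by simp [hN i hi]⟩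
      · simp [rule]
  · have hne : ∀ k, ¬ (tp = k + 1 ∧ r = k + 1) := by intro k; omega
    refine ⟨fun k => min (μ k) (ν k), tp, r, False, ⟨?_, ?_⟩, ?_, ?_, ?_, by simp⟩
    · intro k
      have := hμ.1 k
      have := hν.1 k
      simp only
      omega
    · obtain ⟨N, hN⟩ := hν.2
      exact ⟨N, fun i hi => by simp [hN i hi]⟩
    · intro k
      have a := h1 k
      have b := h2 k
      have c := hne k
      simp only [ind] at *
      split_ifs at * <;> omega
    · intro k
      have a := h1 k
      have b := h2 k
      have c := hne k
      simp only [ind] at *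
      split_ifs at * <;> omega
    · simp only [rule, if_false]
      rw [if_neg hc]

theorem Step.zero {f : ℕ → ℕ} {l : ℕ} {g : ℕ → ℕ} (h : Step f l g) (hg : ∀ k, g k = 0) :
    l = 0 ∧ ∀ k, f k = 0 := by
  constructor
  · by_contra hc
    obtain ⟨k, rfl⟩ : ∃ k, l = k + 1 := ⟨l - 1, by omega⟩
    have := h k
    rw [hg] at this; simp [ind] at this
  · intro k
    have := h k
    rw [hg] at this; omega

theorem surj (m : ℕ) : ∀ (A B : ℕ → ℕ → ℕ) (hb vb : ℕ → ℕ), (∀ t, IsSh (A t)) → (∀ t, IsSh (B t)) →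
    (∀ t < m, Step (B t) (hb t) (A (t + 1))) → (∀ t < m, Step (B t) (vb t) (A t)) →
    (∀ k, A 0 k = 0) → (∀ k, A m k = 0) →
    ∃ X : ℕ → ℕ → Prop, Good X ∧ (∀ t y, X t y → t + y + 2 ≤ m) ∧
      ∀ t y, t + y + 1 = m → H X t y = hb t ∧ V X t y = vb t := by
  induction m with
  | zero =>
    intro A B hb vb _ _ _ _ _ _
    exact ⟨fun _ _ => False, fun _ _ h => h.elim, fun _ _ h => h.elim, fun _ _ h => by omega⟩
  | succ m ih =>
    intro A B hb vb hA hB h1 h2 hA0 hAm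
    have hcell : ∀ t, ∃ (ρ : ℕ → ℕ) (b l : ℕ) (x : Prop), IsSh ρ ∧ (t < m → Step ρ l (B t) ∧
        Step ρ b (B (t + 1)) ∧ rule b l x = (hb t, vb (t + 1)) ∧ (x → b = 0 ∧ l = 0)) := by
      intro t
      by_cases ht : t < m
      · obtain ⟨ρ, b, l, x, e1, e2, e3, e4, e5⟩ := inv_cell (hB t) (hB (t + 1)) (hA (t + 1))
          (h1 t (by omega)) (h2 (t + 1) (by omega))
        exact ⟨ρ, b, l, x, e1, fun _ => ⟨e2, e3, e4, e5⟩⟩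
      · exact ⟨A t, 0, 0, True, hA t, fun h => absurd h ht⟩
    choose ρ b l x e1 e2 using hcell
    have z1 := (h2 0 (by omega)).zero hA0
    have z2 := (h1 m (by omega)).zero hAm
    obtain ⟨X', g1, g2, g3⟩ := ih B ρ b l hB e1 (fun t ht => (e2 t ht).2.1) (fun t ht => (e2 t ht).1)
      z1.2 z2.2
    let X : ℕ → ℕ → Prop := fun t y => X' t y ∨ (t + y + 1 = m ∧ x t)
    have hcg : ∀ t y, t + y < m → H X t y = H X' t y ∧ V X t y = V X' t y := by
      intro t y hty
      refine H_V_congr (m - 1) ?_ (t + y) t y rfl (by omega)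
      intro t y h
      constructor
      · rintro (h' | h')
        · exact h'
        · omega
      · exact Or.inl
    have hXx : ∀ t y, t + y + 1 = m → (X t y ↔ x t) := by
      intro t y h
      constructor
      · rintro (h' | h')
        · have := g2 _ _ h'; omega
        · exact h'.2
      · intro h'; exact Or.inr ⟨h, h'⟩
    refine ⟨X, ?_, ?_, ?_⟩
    · rintro t y (h | ⟨h, h'⟩)
      · have := g2 _ _ h
        have h3 := hcg t y (by omega)
        rw [h3.1, h3.2]; exact g1 _ _ h
      · have h3 := hcg t y (by omega)
        rw [h3.1, h3.2, (g3 t y h).1, (g3 t y h).2]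
        exact (e2 t (by omega)).2.2.2 h'
    · rintro t y (h | ⟨h, h'⟩)
      · have := g2 _ _ h; omega
      · omega
    · intro t y hty
      constructor
      · cases y with
        | zero =>
          obtain rfl : t = m := by omega
          rw [H_zero, z2.1]
        | succ y =>
          have h3 := hcg t y (by omega)
          have h4 := g3 t y (by omega)
          rw [H_succ, h3.1, h3.2, h4.1, h4.2, hXx t y (by omega), (e2 t (by omega)).2.2.1]
      · cases t with
        | zero => rw [V_zero, z1.1]
        | succ t =>
          have h3 := hcg t y (by omega)
          have h4 := g3 t y (by omega)
          rw [V_succ, h3.1, h3.2, h4.1, h4.2, hXx t y (by omega), (e2 t (by omega)).2.2.1]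

/-- transposed boundary shapes -/
def Rel (n : ℕ) (X X' : ℕ → ℕ → Prop) : Prop :=
  ∀ t y, n ≤ t + y + 1 → t + y ≤ n → S X' t y = conj (S X t y)

theorem Rel.symm {n : ℕ} {X X' : ℕ → ℕ → Prop} (hX : Good X) (h : Rel n X X') : Rel n X' X := by
  intro t y h1 h2
  rw [h t y h1 h2, conj_conj (S_sh X hX t y)]

theorem Rel.uniq {n : ℕ} {X X1 X2 : ℕ → ℕ → Prop} (h1 : Rel n X X1) (h2 : Rel n X X2)
    (g1 : Good X1) (g2 : Good X2) (s1 : ∀ t y, X1 t y → t + y + 2 ≤ n)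
    (s2 : ∀ t y, X2 t y → t + y + 2 ≤ n) : ∀ t y, X1 t y ↔ X2 t y := by
  have hb : ∀ t y, t + y + 1 = n → H X1 t y = H X2 t y ∧ V X1 t y = V X2 t y := by
    intro t y h
    have a := (h1 t y (by omega) (by omega)).trans (h2 t y (by omega) (by omega)).symm
    have b := (h1 (t + 1) y (by omega) (by omega)).trans (h2 (t + 1) y (by omega) (by omega)).symm
    have c := (h1 t (y + 1) (by omega) (by omega)).trans (h2 t (y + 1) (by omega) (by omega)).symm
    constructor
    · have p1 : Step (S X1 t y) (H X1 t y) (S X1 (t + 1) y) := S_h X1 t y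
      have p2 : Step (S X2 t y) (H X2 t y) (S X2 (t + 1) y) := S_h X2 t y
      rw [a, b] at p1
      exact p1.uniq p2
    · have p1 : Step (S X1 t y) (V X1 t y) (S X1 t (y + 1)) := S_v X1 g1 t y
      have p2 : Step (S X2 t y) (V X2 t y) (S X2 t (y + 1)) := S_v X2 g2 t y
      rw [a, c] at p1
      exact p1.uniq p2
  intro t y
  by_cases h : t + y + 2 ≤ n
  · exact (inj_aux g1 g2 n hb (n - (t + y + 1)) t y (by omega)).2 (by omega)
  · exact ⟨fun h' => absurd (s1 _ _ h') h, fun h' => absurd (s2 _ _ h') h⟩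

theorem conj_zero {f : ℕ → ℕ} (hf : IsSh f) (h : ∀ k, f k = 0) (k : ℕ) : conj f k = 0 := by
  by_contra hc
  have := (lt_conj hf 0 k).1 (by omega)
  rw [h] at this; omega

theorem Rel.exists (n : ℕ) (X : ℕ → ℕ → Prop) (hX : Good X) :
    ∃ X' : ℕ → ℕ → Prop, Good X' ∧ (∀ t y, X' t y → t + y + 2 ≤ n) ∧ Rel n X X' ∧
      ∀ t y, t + y + 1 = n → (H X' t y = 0 ↔ H X t y = 0) ∧ (V X' t y = 0 ↔ V X t y = 0) := by
  have c1 : ∀ t y, ∃ l', Step (conj (S X t y)) l' (conj (S X (t + 1) y)) ∧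
      (l' = 0 ↔ H X t y = 0) := fun t y =>
    Step.conj_step (S_sh X hX _ _) (S_sh X hX _ _) (S_h X t y)
  have c2 : ∀ t y, ∃ l', Step (conj (S X t y)) l' (conj (S X t (y + 1))) ∧
      (l' = 0 ↔ V X t y = 0) := fun t y =>
    Step.conj_step (S_sh X hX _ _) (S_sh X hX _ _) (S_v X hX t y)
  choose hb hb1 hb2 using c1
  choose vb vb1 vb2 using c2
  obtain ⟨X', g1, g2, g3⟩ := surj n (fun t => conj (S X t (n - t))) (fun t => conj (S X t (n - 1 - t)))
    (fun t => hb t (n - 1 - t)) (fun t => vb t (n - 1 - t))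
    (fun t => conj_sh (S_sh X hX _ _)) (fun t => conj_sh (S_sh X hX _ _))
    (fun t ht => by
      have := hb1 t (n - 1 - t)
      rw [show n - (t + 1) = n - 1 - t by omega]; exact this)
    (fun t ht => by
      have := vb1 t (n - 1 - t)
      rw [show n - 1 - t + 1 = n - t by omega] at this; exact this)
    (conj_zero (S_sh X hX _ _) (S_0 X _))
    (by rw [Nat.sub_self]; exact conj_zero (S_sh X hX _ _) (S_y0 X _))
  have g4 : ∀ t y, t + y + 1 = n → H X' t y = hb t y ∧ V X' t y = vb t y := by
    intro t y h
    have := g3 t y h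
    rw [show n - 1 - t = y by omega] at this
    exact this
  have hA : ∀ t y, t + y = n → S X' t y = conj (S X t y) ∧
      (0 < y → S X' t (y - 1) = conj (S X t (y - 1))) := by
    intro t
    have low : ∀ t y, t + y = n → S X' t y = conj (S X t y) → 0 < y →
        S X' t (y - 1) = conj (S X t (y - 1)) := by
      intro t y h h' hy
      obtain ⟨y, rfl⟩ : ∃ z, y = z + 1 := ⟨y - 1, by omega⟩
      simp only [Nat.add_sub_cancel]
      funext k
      have a := S_v X' g1 t y k
      have b := vb1 t y k
      rw [h', (g4 t y (by omega)).2] at a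
      omega
    induction t with
    | zero =>
      intro y h
      have : S X' 0 y = conj (S X 0 y) := by
        funext k
        rw [S_0, conj_zero (S_sh X hX _ _) (S_0 X _)]
      exact ⟨this, low 0 y h this⟩
    | succ t ih =>
      intro y h
      have e := (ih (y + 1) (by omega)).2 (by omega)
      simp only [Nat.add_sub_cancel] at e
      have : S X' (t + 1) y = conj (S X (t + 1) y) := by
        funext k
        rw [S_h, e, (g4 t y (by omega)).1]
        exact (hb1 t y k).symm
      exact ⟨this, low _ y h this⟩
  refine ⟨X', g1, g2, ?_, ?_⟩
  · intro t y h1 h2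
    by_cases h : t + y = n
    · exact (hA t y h).1
    · exact (hA t (y + 1) (by omega)).2 (by omega)
  · intro t y h
    rw [(g4 t y h).1, (g4 t y h).2]
    exact ⟨hb2 t y, vb2 t y⟩

end GD

namespace SetPartitionA
variable {n : ℕ}

theorem blk_uniq (P : SetPartitionA n) {B B' : Finset ℕ} (hB : B ∈ P.blocks) (hB' : B' ∈ P.blocks)
    {i : ℕ} (h : i ∈ B) (h' : i ∈ B') : B = B' := by
  by_contra hc
  exact Finset.disjoint_left.1 (P.disj B hB B' hB' hc) h h'

theorem blk_mem (P : SetPartitionA n) {B : Finset ℕ} (hB : B ∈ P.blocks) {i : ℕ} (h : i ∈ B) :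
    1 ≤ i ∧ i ≤ n := Finset.mem_Icc.1 ((P.cover i).1 ⟨B, hB, h⟩)

theorem IsArc.bd {P : SetPartitionA n} {i j : ℕ} (h : P.IsArc i j) : 1 ≤ i ∧ i < j ∧ j ≤ n := by
  obtain ⟨h1, B, hB, hi, hj, _⟩ := h
  exact ⟨(P.blk_mem hB hi).1, h1, (P.blk_mem hB hj).2⟩

theorem mem_arcs (P : SetPartitionA n) (p : ℕ × ℕ) : p ∈ P.arcs ↔ P.IsArc p.1 p.2 := by
  unfold arcs
  rw [Finset.mem_filter, Finset.mem_product, Finset.mem_Icc, Finset.mem_Icc]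
  constructor
  · exact fun h => h.2
  · intro h
    have := h.bd
    exact ⟨by omega, h⟩

theorem IsArc.right_uniq {P : SetPartitionA n} {i j k : ℕ} (h : P.IsArc i j) (h' : P.IsArc i k) :
    j = k := by
  obtain ⟨h1, B, hB, hi, hj, hn⟩ := h
  obtain ⟨h1', B', hB', hi', hj', hn'⟩ := h'
  obtain rfl := P.blk_uniq hB hB' hi hi'
  have := hn k hj'
  have := hn' j hj
  omega

theorem IsArc.left_uniq {P : SetPartitionA n} {i j k : ℕ} (h : P.IsArc i k) (h' : P.IsArc j k) :
    i = j := by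
  obtain ⟨h1, B, hB, hi, hj, hn⟩ := h
  obtain ⟨h1', B', hB', hi', hj', hn'⟩ := h'
  obtain rfl := P.blk_uniq hB hB' hj hj'
  have := hn _ hi'
  have := hn' _ hi
  omega

theorem exists_next (P : SetPartitionA n) {B : Finset ℕ} (hB : B ∈ P.blocks) {i j : ℕ} (hi : i ∈ B)
    (hj : j ∈ B) (h : i < j) : ∃ k ∈ B, k ≤ j ∧ P.IsArc i k := by
  obtain ⟨k, hk, hm⟩ := (B.filter fun k => i < k).exists_min_image id ⟨j, by simp [hj, h]⟩
  rw [Finset.mem_filter] at hk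
  have hm' : ∀ x ∈ B, i < x → k ≤ x := fun x hx hx' => hm x (by simp [hx, hx'])
  refine ⟨k, hk.1, hm' j hj h, hk.2, B, hB, hi, hk.1, fun l hl => ?_⟩
  rintro ⟨h1, h2⟩
  have := hm' l hl h1
  omega

theorem exists_prev (P : SetPartitionA n) {B : Finset ℕ} (hB : B ∈ P.blocks) {i j : ℕ} (hi : i ∈ B)
    (hj : j ∈ B) (h : j < i) : ∃ k, P.IsArc k i := by
  obtain ⟨k, hk, hm⟩ := (B.filter fun k => k < i).exists_max_image id ⟨j, by simp [hj, h]⟩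
  rw [Finset.mem_filter] at hk
  have hm' : ∀ x ∈ B, x < i → x ≤ k := fun x hx hx' => hm x (by simp [hx, hx'])
  refine ⟨k, hk.2, B, hB, hk.1, hi, fun l hl => ?_⟩
  rintro ⟨h1, h2⟩
  have := hm' l hl h2
  omega

theorem mem_openers (P : SetPartitionA n) (i : ℕ) : i ∈ P.openers ↔ ∃ j, P.IsArc i j := by
  unfold openers
  rw [Finset.mem_filter, Finset.mem_Icc]
  constructor
  · rintro ⟨_, B, hB, hi, j, hj, h⟩
    obtain ⟨k, _, _, hk⟩ := P.exists_next hB hi hj h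
    exact ⟨k, hk⟩
  · rintro ⟨j, h⟩
    have := h.bd
    obtain ⟨h1, B, hB, hi, hj, hn⟩ := h
    exact ⟨by omega, B, hB, hi, j, hj, h1⟩

theorem mem_closers (P : SetPartitionA n) (i : ℕ) : i ∈ P.closers ↔ ∃ j, P.IsArc j i := by
  unfold closers
  rw [Finset.mem_filter, Finset.mem_Icc]
  constructor
  · rintro ⟨_, B, hB, hi, j, hj, h⟩
    exact P.exists_prev hB hi hj h
  · rintro ⟨j, h⟩
    have := h.bd
    obtain ⟨h1, B, hB, hi, hj, hn⟩ := h
    exact ⟨by omega, B, hB, hj, j, hi, h1⟩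

theorem same_of (P Q : SetPartitionA n) (h : ∀ i j, P.IsArc i j → Q.IsArc i j) (d : ℕ) :
    ∀ B ∈ P.blocks, ∀ i ∈ B, ∀ j ∈ B, i ≤ j → j - i = d → ∃ B' ∈ Q.blocks, i ∈ B' ∧ j ∈ B' := by
  induction d using Nat.strong_induction_on with
  | _ d ih =>
    intro B hB i hi j hj hij hd
    rcases Nat.eq_or_lt_of_le hij with rfl | hlt
    · obtain ⟨B', hB', h'⟩ := (Q.cover i).2 ((P.cover i).1 ⟨B, hB, hi⟩)
      exact ⟨B', hB', h', h'⟩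
    · obtain ⟨k, hk, hkj, ha⟩ := P.exists_next hB hi hj hlt
      have hik := ha.1
      obtain ⟨B1, hB1, m1, m2⟩ := ih (j - k) (by omega) B hB k hk j hj hkj rfl
      obtain ⟨_, B2, hB2, m3, m4, _⟩ := h _ _ ha
      obtain rfl := Q.blk_uniq hB1 hB2 m1 m4
      exact ⟨B1, hB1, m3, m2⟩

theorem blocks_sub (P Q : SetPartitionA n) (h : ∀ i j, P.IsArc i j ↔ Q.IsArc i j) :
    P.blocks ⊆ Q.blocks := by
  have key : ∀ (P Q : SetPartitionA n), (∀ i j, P.IsArc i j → Q.IsArc i j) →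
      ∀ B ∈ P.blocks, ∀ i ∈ B, ∀ j ∈ B, ∃ B' ∈ Q.blocks, i ∈ B' ∧ j ∈ B' := by
    intro P Q h B hB i hi j hj
    rcases le_total i j with hij | hij
    · exact same_of P Q h _ B hB i hi j hj hij rfl
    · obtain ⟨B', h1, h2, h3⟩ := same_of P Q h _ B hB j hj i hi hij rfl
      exact ⟨B', h1, h3, h2⟩
  intro B hB
  obtain ⟨i, hi⟩ := P.nonempty B hB
  obtain ⟨B', hB', hi', _⟩ := key P Q (fun i j => (h i j).1) B hB i hi i hi
  have : B = B' := by
    ext j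
    constructor
    · intro hj
      obtain ⟨B2, hB2, m1, m2⟩ := key P Q (fun i j => (h i j).1) B hB i hi j hj
      rwa [Q.blk_uniq hB' hB2 hi' m1]
    · intro hj
      obtain ⟨B2, hB2, m1, m2⟩ := key Q P (fun i j => (h i j).2) B' hB' i hi' j hj
      rwa [P.blk_uniq hB hB2 hi m1]
  rwa [this]

theorem ext_arcs (P Q : SetPartitionA n) (h : ∀ i j, P.IsArc i j ↔ Q.IsArc i j) : P = Q := by
  have : P.blocks = Q.blocks :=
    (blocks_sub P Q h).antisymm (blocks_sub Q P fun i j => (h i j).symm)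
  cases P; cases Q; simp only at this; subst this; rfl

theorem exists_of_arcs (r : ℕ → ℕ → Prop) (hb : ∀ i j, r i j → 1 ≤ i ∧ i < j ∧ j ≤ n)
    (h1 : ∀ i j k, r i j → r i k → j = k) (h2 : ∀ i j k, r i k → r j k → i = j) :
    ∃ P : SetPartitionA n, ∀ i j, P.IsArc i j ↔ r i j := by
  let R := Relation.ReflTransGen r
  have hRle : ∀ i j, R i j → i ≤ j := by
    intro i j h
    induction h with
    | refl => exact le_rfl
    | tail _ h ih => have := hb _ _ h; omega
  have tot1 : ∀ i j k, R i j → R i k → R j k ∨ R k j := fun i j k a b =>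
    Relation.ReflTransGen.total_of_right_unique (fun a b c h h' => h1 a b c h h') a b
  have tot2 : ∀ i j k, R j i → R k i → R j k ∨ R k j := by
    intro i j k a b
    have := Relation.ReflTransGen.total_of_right_unique (r := Function.swap r)
      (fun a b c h h' => h2 b c a h h') (Relation.reflTransGen_swap.2 a)
      (Relation.reflTransGen_swap.2 b)
    rcases this with h | h
    · exact Or.inr (Relation.reflTransGen_swap.1 h)
    · exact Or.inl (Relation.reflTransGen_swap.1 h)
  let E : ℕ → ℕ → Prop := fun i j => R i j ∨ R j i
  have Esymm : ∀ i j, E i j → E j i := fun i j h => h.symm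
  have Erefl : ∀ i, E i i := fun i => Or.inl Relation.ReflTransGen.refl
  have Etrans : ∀ i j k, E i j → E j k → E i k := by
    rintro i j k (a | a) (b | b)
    · exact Or.inl (a.trans b)
    · exact tot2 _ _ _ a b
    · exact tot1 _ _ _ a b
    · exact Or.inr (b.trans a)
  have Elt : ∀ i j, E i j → i < j → ∃ k, r i k ∧ R k j := by
    intro i j h hij
    have h : R i j := by
      rcases h with h | h
      · exact h
      · have := hRle _ _ h; omega
    rcases Relation.ReflTransGen.cases_head h with rfl | h
    · omega
    · exact h
  let cls : ℕ → Finset ℕ := fun i => (Finset.Icc 1 n).filter fun j => E i j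
  have mem_cls : ∀ i j, j ∈ cls i ↔ (1 ≤ j ∧ j ≤ n) ∧ E i j := by
    intro i j; simp only [cls, Finset.mem_filter, Finset.mem_Icc]
  let P : SetPartitionA n :=
    { blocks := (Finset.Icc 1 n).image cls
      nonempty := by
        intro B hB
        obtain ⟨i, hi, rfl⟩ := Finset.mem_image.1 hB
        exact ⟨i, (mem_cls i i).2 ⟨Finset.mem_Icc.1 hi, Erefl i⟩⟩
      disj := by
        intro B hB B' hB' hne
        obtain ⟨i, hi, rfl⟩ := Finset.mem_image.1 hB
        obtain ⟨j, hj, rfl⟩ := Finset.mem_image.1 hB'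
        rw [Finset.disjoint_left]
        intro k hk hk'
        apply hne
        have e1 := ((mem_cls _ _).1 hk).2
        have e2 := ((mem_cls _ _).1 hk').2
        ext l
        rw [mem_cls, mem_cls]
        constructor
        · rintro ⟨a, b⟩
          exact ⟨a, Etrans _ _ _ e2 (Etrans _ _ _ (Esymm _ _ e1) b)⟩
        · rintro ⟨a, b⟩
          exact ⟨a, Etrans _ _ _ e1 (Etrans _ _ _ (Esymm _ _ e2) b)⟩
      cover := by
        intro i
        constructor
        · rintro ⟨B, hB, hi⟩
          obtain ⟨j, hj, rfl⟩ := Finset.mem_image.1 hB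
          exact Finset.mem_Icc.2 ((mem_cls _ _).1 hi).1
        · intro hi
          exact ⟨cls i, Finset.mem_image_of_mem _ hi,
            (mem_cls i i).2 ⟨Finset.mem_Icc.1 hi, Erefl i⟩⟩ }
  refine ⟨P, fun i j => ?_⟩
  constructor
  · rintro ⟨hij, B, hB, hi, hj, hn⟩
    obtain ⟨c, hc, rfl⟩ := Finset.mem_image.1 hB
    have mi := (mem_cls _ _).1 hi
    have mj := (mem_cls _ _).1 hj
    obtain ⟨k, hk, hkj⟩ := Elt i j (Etrans _ _ _ (Esymm _ _ mi.2) mj.2) hij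
    have hbk := hb _ _ hk
    have hle := hRle _ _ hkj
    have := hn k ((mem_cls _ _).2 ⟨by omega,
      Etrans _ _ _ mi.2 (Or.inl (Relation.ReflTransGen.single hk))⟩)
    obtain rfl : k = j := by omega
    exact hk
  · intro h
    have hbk := hb _ _ h
    refine ⟨hbk.2.1, cls i, Finset.mem_image_of_mem _ (Finset.mem_Icc.2 (by omega)),
      (mem_cls _ _).2 ⟨by omega, Erefl i⟩,
      (mem_cls _ _).2 ⟨by omega, Or.inl (Relation.ReflTransGen.single h)⟩, ?_⟩
    rintro k hk ⟨hk1, hk2⟩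
    obtain ⟨l, hl, hlk⟩ := Elt i k ((mem_cls _ _).1 hk).2 hk1
    obtain rfl := h1 _ _ _ h hl
    have := hRle _ _ hlk
    omega

/-- filling -/
def fill (P : SetPartitionA n) (t y : ℕ) : Prop := P.IsArc (t + 1) (n - y)

theorem fill_bd (P : SetPartitionA n) (t y : ℕ) (h : P.fill t y) : t + y + 2 ≤ n := by
  have := IsArc.bd h
  omega

theorem fill_good (P : SetPartitionA n) : GD.Good P.fill := by
  apply GD.good_of_inj
  · intro t y z h h'
    have := P.fill_bd _ _ h
    have := P.fill_bd _ _ h'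
    have := IsArc.right_uniq h h'
    omega
  · intro s t y h h'
    have := IsArc.left_uniq h h'
    omega

theorem arc_iff_fill (P : SetPartitionA n) (i j : ℕ) :
    P.IsArc i j ↔ 1 ≤ i ∧ j ≤ n ∧ P.fill (i - 1) (n - j) := by
  unfold fill
  constructor
  · intro h
    have := h.bd
    rw [show i - 1 + 1 = i by omega, show n - (n - j) = j by omega]
    exact ⟨by omega, by omega, h⟩
  · rintro ⟨h1, h2, h⟩
    rwa [show i - 1 + 1 = i by omega, show n - (n - j) = j by omega] at h

theorem arcs_to_C (P : SetPartitionA n) (Y d : ℕ) : ∀ (T y0 : ℕ) (s : Finset (ℕ × ℕ)), s.card = d →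
    s ⊆ P.arcs → (∀ a ∈ s, ∀ b ∈ s, a ≠ b → ACross a b) →
    (∀ a ∈ s, a.1 ≤ T ∧ a.2 + y0 ≤ n ∧ n < a.2 + Y) → GD.C P.fill Y d T y0 := by
  induction d with
  | zero => intros; trivial
  | succ d ih =>
    intro T y0 s hc hs hp hb
    obtain ⟨a, ha, hmax⟩ := s.exists_max_image Prod.fst (Finset.card_pos.1 (by omega))
    have harc := (P.mem_arcs a).1 (hs ha)
    have hbd := harc.bd
    have hba := hb a ha
    refine ⟨a.1 - 1, n - a.2, by omega, by omega, by omega, ((P.arc_iff_fill _ _).1 harc).2.2, ?_⟩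
    refine ih _ _ (s.erase a) (by rw [Finset.card_erase_of_mem ha]; omega)
      ((Finset.erase_subset _ _).trans hs)
      (fun b hb c hc => hp b (Finset.mem_of_mem_erase hb) c (Finset.mem_of_mem_erase hc)) ?_
    intro b hb'
    have hbs := Finset.mem_of_mem_erase hb'
    have h1 := hmax b hbs
    have h2 := hb b hbs
    have h3 := hp a ha b hbs (Finset.ne_of_mem_erase hb').symm
    unfold ACross at h3
    omega

theorem C_to_arcs (P : SetPartitionA n) (Y d : ℕ) : ∀ (T y0 : ℕ), T + Y ≤ n →
    GD.C P.fill Y d T y0 → ∃ s : Finset (ℕ × ℕ), s.card = d ∧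
    s ⊆ P.arcs ∧ (∀ a ∈ s, ∀ b ∈ s, a ≠ b → ACross a b) ∧
    (∀ a ∈ s, a.1 ≤ T ∧ a.2 + y0 ≤ n ∧ n < a.2 + Y) := by
  induction d with
  | zero => intro T y0 _ _; exact ⟨∅, by simp⟩
  | succ d ih =>
    rintro T y0 hT ⟨t, y, h1, h2, h3, h4, h5⟩
    obtain ⟨s, e1, e2, e3, e4⟩ := ih t (y + 1) (by omega) h5
    have hbd := IsArc.bd h4
    have hcr : ∀ b ∈ s, b.1 < t + 1 ∧ t + 1 < b.2 ∧ b.2 < n - y := by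
      intro b hb
      have := e4 b hb
      omega
    refine ⟨insert (t + 1, n - y) s, ?_, ?_, ?_, ?_⟩
    · rw [Finset.card_insert_of_notMem, e1]
      intro hm
      have := hcr _ hm
      simp only at this
      omega
    · intro a ha
      rcases Finset.mem_insert.1 ha with rfl | ha
      · exact (P.mem_arcs _).2 h4
      · exact e2 ha
    · intro a ha b hb hne
      rcases Finset.mem_insert.1 ha with rfl | ha <;> rcases Finset.mem_insert.1 hb with rfl | hb
      · exact absurd rfl hne
      · exact Or.inr (hcr b hb)
      · exact Or.inl (hcr a ha)
      · exact e3 a ha b hb hne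
    · intro a ha
      rcases Finset.mem_insert.1 ha with rfl | ha
      · simp only; omega
      · have := e4 a ha; omega

theorem arcs_to_I (P : SetPartitionA n) (d : ℕ) : ∀ (T Y : ℕ) (s : Finset (ℕ × ℕ)), s.card = d →
    s ⊆ P.arcs → (∀ a ∈ s, ∀ b ∈ s, a ≠ b → ANest a b) →
    (∀ a ∈ s, a.1 ≤ T ∧ n < a.2 + Y) → GD.I P.fill d T Y := by
  induction d with
  | zero => intros; trivial
  | succ d ih =>
    intro T Y s hc hs hp hb
    obtain ⟨a, ha, hmax⟩ := s.exists_max_image Prod.fst (Finset.card_pos.1 (by omega))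
    have harc := (P.mem_arcs a).1 (hs ha)
    have hbd := harc.bd
    have hba := hb a ha
    refine ⟨a.1 - 1, n - a.2, by omega, by omega, ((P.arc_iff_fill _ _).1 harc).2.2, ?_⟩
    refine ih _ _ (s.erase a) (by rw [Finset.card_erase_of_mem ha]; omega)
      ((Finset.erase_subset _ _).trans hs)
      (fun b hb c hc => hp b (Finset.mem_of_mem_erase hb) c (Finset.mem_of_mem_erase hc)) ?_
    intro b hb'
    have hbs := Finset.mem_of_mem_erase hb'
    have h1 := hmax b hbs
    have h2 := hb b hbs
    have h3 := hp a ha b hbs (Finset.ne_of_mem_erase hb').symm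
    unfold ANest at h3
    omega

theorem I_to_arcs (P : SetPartitionA n) (d : ℕ) : ∀ (T Y : ℕ),
    GD.I P.fill d T Y → ∃ s : Finset (ℕ × ℕ), s.card = d ∧
    s ⊆ P.arcs ∧ (∀ a ∈ s, ∀ b ∈ s, a ≠ b → ANest a b) ∧
    (∀ a ∈ s, a.1 ≤ T ∧ n < a.2 + Y) := by
  induction d with
  | zero => intro T Y _; exact ⟨∅, by simp⟩
  | succ d ih =>
    rintro T Y ⟨t, y, h1, h2, h4, h5⟩
    obtain ⟨s, e1, e2, e3, e4⟩ := ih t y h5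
    have hbd := IsArc.bd h4
    have hcr : ∀ b ∈ s, b.1 < t + 1 ∧ t + 1 < n - y ∧ n - y < b.2 := by
      intro b hb
      have := e4 b hb
      omega
    refine ⟨insert (t + 1, n - y) s, ?_, ?_, ?_, ?_⟩
    · rw [Finset.card_insert_of_notMem, e1]
      intro hm
      have := hcr _ hm
      simp only at this
      omega
    · intro a ha
      rcases Finset.mem_insert.1 ha with rfl | ha
      · exact (P.mem_arcs _).2 h4
      · exact e2 ha
    · intro a ha b hb hne
      rcases Finset.mem_insert.1 ha with rfl | ha <;> rcases Finset.mem_insert.1 hb with rfl | hb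
      · exact absurd rfl hne
      · exact Or.inr (hcr b hb)
      · exact Or.inl (hcr a ha)
      · exact e3 a ha b hb hne
    · intro a ha
      rcases Finset.mem_insert.1 ha with rfl | ha
      · simp only; omega
      · have := e4 a ha; omega

theorem le_maxCrossing (P : SetPartitionA n) (k : ℕ) :
    k ≤ P.maxCrossing ↔ ∃ T ≤ n, k ≤ GD.conj (GD.S P.fill T (n - T)) 0 := by
  rcases Nat.eq_zero_or_pos k with rfl | hk
  · exact ⟨fun _ => ⟨0, by omega, by omega⟩, fun _ => by omega⟩
  unfold maxCrossing
  rw [Finset.le_sup_iff (by simpa using hk)]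
  simp only [← GD.dec_iff P.fill P.fill_good, Finset.mem_filter, Finset.mem_powerset]
  constructor
  · rintro ⟨s, ⟨hs, hp⟩, hc⟩
    obtain ⟨s', hs', hc'⟩ := Finset.exists_subset_card_eq hc
    obtain ⟨a, ha, hmax⟩ := s'.exists_max_image Prod.fst (Finset.card_pos.1 (by omega))
    have hp' : ∀ a ∈ s', ∀ b ∈ s', a ≠ b → ACross a b :=
      fun a ha b hb => hp a (hs' ha) b (hs' hb)
    have hbd := ((P.mem_arcs a).1 (hs (hs' ha))).bd
    refine ⟨a.1, by omega, P.arcs_to_C _ _ _ _ s' hc' (hs'.trans hs) hp' ?_⟩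
    intro b hb
    have hbd' := ((P.mem_arcs b).1 (hs (hs' hb))).bd
    have := hmax b hb
    by_cases hab : a = b
    · subst hab; omega
    · have h3 := hp' a ha b hb hab
      unfold ACross at h3
      omega
  · rintro ⟨T, hT, h⟩
    obtain ⟨s, e1, e2, e3, _⟩ := P.C_to_arcs _ _ _ _ (by omega) h
    exact ⟨s, ⟨e2, e3⟩, e1.ge⟩

theorem le_maxNesting (P : SetPartitionA n) (k : ℕ) :
    k ≤ P.maxNesting ↔ ∃ T ≤ n, k ≤ GD.S P.fill T (n - T) 0 := by
  rcases Nat.eq_zero_or_pos k with rfl | hk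
  · exact ⟨fun _ => ⟨0, by omega, by omega⟩, fun _ => by omega⟩
  unfold maxNesting
  rw [Finset.le_sup_iff (by simpa using hk)]
  simp only [← GD.inc_iff P.fill P.fill_good, Finset.mem_filter, Finset.mem_powerset]
  constructor
  · rintro ⟨s, ⟨hs, hp⟩, hc⟩
    obtain ⟨s', hs', hc'⟩ := Finset.exists_subset_card_eq hc
    obtain ⟨a, ha, hmax⟩ := s'.exists_max_image Prod.fst (Finset.card_pos.1 (by omega))
    have hp' : ∀ a ∈ s', ∀ b ∈ s', a ≠ b → ANest a b :=
      fun a ha b hb => hp a (hs' ha) b (hs' hb)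
    have hbd := ((P.mem_arcs a).1 (hs (hs' ha))).bd
    refine ⟨a.1, by omega, P.arcs_to_I _ _ _ s' hc' (hs'.trans hs) hp' ?_⟩
    intro b hb
    have hbd' := ((P.mem_arcs b).1 (hs (hs' hb))).bd
    have := hmax b hb
    by_cases hab : a = b
    · subst hab; omega
    · have h3 := hp' a ha b hb hab
      unfold ANest at h3
      omega
  · rintro ⟨T, hT, h⟩
    obtain ⟨s, e1, e2, e3, _⟩ := P.I_to_arcs _ _ _ h
    exact ⟨s, ⟨e2, e3⟩, e1.ge⟩

theorem opener_iff (P : SetPartitionA n) (i : ℕ) :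
    i ∈ P.openers ↔ 1 ≤ i ∧ i ≤ n ∧ GD.H P.fill (i - 1) (n - i) ≠ 0 := by
  rw [mem_openers, GD.H_ne_zero]
  constructor
  · rintro ⟨j, h⟩
    have := h.bd
    exact ⟨by omega, by omega, n - j, by omega, ((P.arc_iff_fill _ _).1 h).2.2⟩
  · rintro ⟨h1, h2, y, hy, h⟩
    refine ⟨n - y, ?_⟩
    unfold fill at h
    rwa [show i - 1 + 1 = i by omega] at h

theorem closer_iff (P : SetPartitionA n) (j : ℕ) :
    j ∈ P.closers ↔ 1 ≤ j ∧ j ≤ n ∧ GD.V P.fill (j - 1) (n - j) ≠ 0 := by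
  rw [mem_closers, GD.V_ne_zero]
  constructor
  · rintro ⟨i, h⟩
    have := h.bd
    exact ⟨by omega, by omega, i - 1, by omega, ((P.arc_iff_fill _ _).1 h).2.2⟩
  · rintro ⟨h1, h2, t, ht, h⟩
    refine ⟨t + 1, ?_⟩
    unfold fill at h
    rwa [show n - (n - j) = j by omega] at h

theorem exists_partner (P : SetPartitionA n) : ∃ Q : SetPartitionA n, GD.Rel n P.fill Q.fill ∧
    Q.openers = P.openers ∧ Q.closers = P.closers := by
  obtain ⟨X', g1, g2, g3, g4⟩ := GD.Rel.exists n P.fill P.fill_good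
  obtain ⟨Q, hQ⟩ := exists_of_arcs (n := n)
    (fun i j => 1 ≤ i ∧ j ≤ n ∧ X' (i - 1) (n - j))
    (by rintro i j ⟨h1, h2, h3⟩
        have := g2 _ _ h3
        omega)
    (by rintro i j k ⟨h1, h2, h3⟩ ⟨h1', h2', h3'⟩
        have := g1.inj1 h3 h3'
        omega)
    (by rintro i j k ⟨h1, h2, h3⟩ ⟨h1', h2', h3'⟩
        have := g1.inj2 h3 h3'
        omega)
  have hfill : Q.fill = X' := by
    funext t y
    apply propext
    unfold fill
    rw [hQ]
    constructor
    · rintro ⟨h1, h2, h3⟩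
      have := g2 _ _ h3
      have hy : n - (n - y) = y := by
        by_contra hc
        omega
      rwa [Nat.add_sub_cancel, hy] at h3
    · intro h
      have := g2 _ _ h
      rw [Nat.add_sub_cancel, show n - (n - y) = y by omega]
      exact ⟨by omega, by omega, h⟩
  refine ⟨Q, hfill ▸ g3, ?_, ?_⟩
  · ext i
    rw [opener_iff, opener_iff, hfill]
    constructor
    · rintro ⟨h1, h2, h3⟩
      exact ⟨h1, h2, fun h => h3 ((g4 _ _ (by omega)).1.2 h)⟩
    · rintro ⟨h1, h2, h3⟩
      exact ⟨h1, h2, fun h => h3 ((g4 _ _ (by omega)).1.1 h)⟩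
  · ext i
    rw [closer_iff, closer_iff, hfill]
    constructor
    · rintro ⟨h1, h2, h3⟩
      exact ⟨h1, h2, fun h => h3 ((g4 _ _ (by omega)).2.2 h)⟩
    · rintro ⟨h1, h2, h3⟩
      exact ⟨h1, h2, fun h => h3 ((g4 _ _ (by omega)).2.1 h)⟩

theorem partner_max {P Q : SetPartitionA n} (h : GD.Rel n P.fill Q.fill) :
    Q.maxNesting = P.maxCrossing := by
  apply eq_of_forall_le_iff
  intro k
  rw [le_maxNesting, le_maxCrossing]
  constructor
  · rintro ⟨T, hT, hk⟩
    rw [h T (n - T) (by omega) (by omega)] at hk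
    exact ⟨T, hT, hk⟩
  · rintro ⟨T, hT, hk⟩
    rw [← h T (n - T) (by omega) (by omega)] at hk
    exact ⟨T, hT, hk⟩

theorem partner_uniq {P Q R : SetPartitionA n} (h : GD.Rel n P.fill Q.fill)
    (h' : GD.Rel n P.fill R.fill) : Q = R := by
  apply ext_arcs
  intro i j
  rw [arc_iff_fill, arc_iff_fill,
    GD.Rel.uniq h h' Q.fill_good R.fill_good Q.fill_bd R.fill_bd]

end SetPartitionA


theorem stmt3 (n : ℕ) (hn : 0 < n) :
    ∃ Φ : SetPartitionA n → SetPartitionA n, Function.Bijective Φ ∧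
      ∀ P : SetPartitionA n,
        (Φ P).openers = P.openers ∧ (Φ P).closers = P.closers ∧
        (Φ P).maxCrossing = P.maxNesting ∧ (Φ P).maxNesting = P.maxCrossing := by
  choose Φ hΦ using fun P : SetPartitionA n => P.exists_partner
  have hsymm : ∀ P, GD.Rel n (Φ P).fill P.fill := fun P => (hΦ P).1.symm P.fill_good
  have hinv : Function.Involutive Φ := fun P =>
    SetPartitionA.partner_uniq (hΦ (Φ P)).1 (hsymm P)
  exact ⟨Φ, hinv.bijective, fun P => ⟨(hΦ P).2.1, (hΦ P).2.2,
    (SetPartitionA.partner_max (hsymm P)).symm, SetPartitionA.partner_max (hΦ P).1⟩⟩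
end
end

section
/- For every positive integer n there exists a bijection Φ on the set of set partitions of type C_n such that for every type C_n set partition 𝓑: op(Φ(𝓑)) = op(𝓑), cl(Φ(𝓑)) = cl(𝓑), the number of crossings of Φ(𝓑) equals the number of nestings of 𝓑, and the number of nestings of Φ(𝓑) equals the number of crossings of 𝓑. -/
open scoped Classical
noncomputable section

/-! ### Part A: partitions from arc relations -/

namespace X4

def InPm (n : ℕ) (i : ℤ) : Prop := i ≠ 0 ∧ -(n:ℤ) ≤ i ∧ i ≤ n

theorem inPm_iff (n : ℕ) (i : ℤ) : InPm n i ↔ (i ≠ 0 ∧ |i| ≤ (n:ℤ)) := by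
  unfold InPm; rw [abs_le]

theorem mem_pmn (n : ℕ) (i : ℤ) : i ∈ SetPartitionC.pmn n ↔ InPm n i := by
  unfold SetPartitionC.pmn InPm; simp

theorem InPm.neg {n : ℕ} {i : ℤ} (h : InPm n i) : InPm n (-i) := by
  unfold InPm at *; omega

theorem ord_neg {n : ℕ} {i : ℤ} (h : InPm n i) : nestOrd n (-i) = 2*n+1 - nestOrd n i := by
  unfold InPm at h; unfold nestOrd; split_ifs <;> omega

theorem ord_inj {n : ℕ} {i j : ℤ} (h : InPm n i) (h' : InPm n j)
    (e : nestOrd n i = nestOrd n j) : i = j := by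
  unfold InPm at h h'; unfold nestOrd at e; split_ifs at e <;> omega

theorem ord_pos {n : ℕ} {i : ℤ} (h : 0 < i) : nestOrd n i = i := by
  unfold nestOrd; rw [if_pos h]

theorem ord_npos {n : ℕ} {i : ℤ} (h : ¬ 0 < i) : nestOrd n i = 2*n+1+i := by
  unfold nestOrd; rw [if_neg h]

theorem mem_negSet (B : Finset ℤ) (x : ℤ) : x ∈ negSet B ↔ -x ∈ B := by
  unfold negSet
  simp only [Finset.mem_image]
  constructor
  · rintro ⟨y, hy, rfl⟩; simpa using hy
  · intro h; exact ⟨-x, h, by simp⟩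

structure Good (n : ℕ) (R : ℤ → ℤ → Prop) : Prop where
  mem : ∀ i j, R i j → InPm n i ∧ InPm n j ∧ nestOrd n i < nestOrd n j
  ru : ∀ i j k, R i j → R i k → j = k
  lu : ∀ i j k, R i k → R j k → i = j
  sy : ∀ i j, R i j → R (-j) (-i)
  fx : ∀ i k, R i (-i) → R k (-k) → i = k

open Relation

section
variable {n : ℕ} {R : ℤ → ℤ → Prop}

theorem Good.le (h : Good n R) {i j : ℤ} (H : ReflTransGen R i j) :
    nestOrd n i ≤ nestOrd n j := by
  induction H with
  | refl => exact le_rfl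
  | tail _ h2 ih => exact ih.trans (h.mem _ _ h2).2.2.le

theorem Good.memr (h : Good n R) {i j : ℤ} (hi : InPm n i) (H : ReflTransGen R i j) :
    InPm n j := by
  induction H with
  | refl => exact hi
  | tail _ h2 ih => exact (h.mem _ _ h2).2.1

def Sim (R : ℤ → ℤ → Prop) (i j : ℤ) : Prop := ReflTransGen R i j ∨ ReflTransGen R j i

theorem Sim.symm {i j : ℤ} (h : Sim R i j) : Sim R j i := Or.symm h

theorem Good.trans (h : Good n R) {i j k : ℤ} (h1 : Sim R i j) (h2 : Sim R j k) :
    Sim R i k := by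
  have hr : Relator.RightUnique R := fun a b c => h.ru a b c
  have hl : Relator.RightUnique (Function.swap R) := fun a b c x y => h.lu b c a x y
  rcases h1 with h1 | h1 <;> rcases h2 with h2 | h2
  · exact Or.inl (h1.trans h2)
  · have := ReflTransGen.total_of_right_unique hl (reflTransGen_swap.2 h1) (reflTransGen_swap.2 h2)
    rcases this with t | t
    · exact Or.inr (reflTransGen_swap.1 t)
    · exact Or.inl (reflTransGen_swap.1 t)
  · exact ReflTransGen.total_of_right_unique hr h1 h2
  · exact Or.inr (h2.trans h1)

theorem Good.rneg (h : Good n R) {i j : ℤ} (H : ReflTransGen R i j) :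
    ReflTransGen R (-j) (-i) := by
  induction H with
  | refl => exact ReflTransGen.refl
  | tail _ h2 ih => exact ReflTransGen.head (h.sy _ _ h2) ih

theorem Good.sneg (h : Good n R) {i j : ℤ} (H : Sim R i j) : Sim R (-i) (-j) := by
  rcases H with H | H
  · exact Or.inr (h.rneg H)
  · exact Or.inl (h.rneg H)

/-- A nontrivial chain starts with an arc. -/
theorem Good.first (h : Good n R) {i j : ℤ} (H : Sim R i j) (hlt : nestOrd n i < nestOrd n j) :
    ∃ k, R i k ∧ ReflTransGen R k j := by
  rcases H with H | H
  · rcases ReflTransGen.cases_head H with e | e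
    · subst e; omega
    · exact e
  · have := h.le H; omega

def cls (n : ℕ) (R : ℤ → ℤ → Prop) (i : ℤ) : Finset ℤ :=
  (SetPartitionC.pmn n).filter fun j => Sim R i j

theorem mem_cls (i j : ℤ) : j ∈ cls n R i ↔ InPm n j ∧ Sim R i j := by
  unfold cls; rw [Finset.mem_filter, mem_pmn]

theorem Good.cls_eq (h : Good n R) {i j : ℤ} (H : Sim R i j) : cls n R i = cls n R j := by
  ext k
  rw [mem_cls, mem_cls]
  exact ⟨fun a => ⟨a.1, h.trans H.symm a.2⟩, fun a => ⟨a.1, h.trans H a.2⟩⟩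

theorem sim_refl (i : ℤ) : Sim R i i := Or.inl ReflTransGen.refl

theorem Good.neg_cls (h : Good n R) (i : ℤ) : negSet (cls n R i) = cls n R (-i) := by
  ext k
  rw [mem_negSet, mem_cls, mem_cls]
  constructor
  · rintro ⟨a, b⟩
    refine ⟨by simpa using a.neg, by simpa using h.sneg b⟩
  · rintro ⟨a, b⟩
    refine ⟨a.neg, by simpa using h.sneg b⟩

theorem Good.zero (h : Good n R) {i : ℤ} (hi : InPm n i) (H : cls n R (-i) = cls n R i) :
    ∃ k ∈ cls n R i, R k (-k) := by
  have hneg : ∀ k ∈ cls n R i, -k ∈ cls n R i := by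
    intro k hk
    rw [← H, ← h.neg_cls, mem_negSet]; simpa using hk
  have hii : i ∈ cls n R i := by rw [mem_cls]; exact ⟨hi, sim_refl i⟩
  have hne : ((cls n R i).filter fun k => 0 < k).Nonempty := by
    rcases lt_or_ge 0 i with hp | hp
    · exact ⟨i, by simp [hii, hp]⟩
    · refine ⟨-i, ?_⟩
      have := hi.1
      simp only [Finset.mem_filter]
      exact ⟨hneg i hii, by omega⟩
  obtain ⟨m, hm, hmax⟩ := Finset.exists_max_image _ (fun k => k) hne
  rw [Finset.mem_filter] at hm
  obtain ⟨hm, hmp⟩ := hm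
  refine ⟨m, hm, ?_⟩
  have hm' := (mem_cls _ _).1 hm
  have hmn := (mem_cls _ _).1 (hneg m hm)
  have hs : Sim R m (-m) := h.trans hm'.2.symm hmn.2
  have hlt : nestOrd n m < nestOrd n (-m) := by
    have := hm'.1.2.2
    rw [ord_pos hmp, ord_npos (by omega)]; omega
  obtain ⟨k, hk, hk2⟩ := h.first hs hlt
  have hkm := h.mem _ _ hk
  have hkc : k ∈ cls n R i := by
    rw [mem_cls]; exact ⟨hkm.2.1, h.trans hm'.2 (Or.inl (ReflTransGen.single hk))⟩
  have hle := h.le hk2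
  have : k = -m := by
    rcases lt_or_ge 0 k with hp | hp
    · have := hmax k (by simp [hkc, hp])
      have h3 := hkm.2.2
      rw [ord_pos hmp, ord_pos hp] at h3
      omega
    · have h0 := hkm.2.1.1
      have := hmax (-k) (by rw [Finset.mem_filter]; exact ⟨hneg k hkc, by omega⟩)
      rw [ord_npos (by omega), ord_npos (by omega)] at hle
      omega
  rw [this] at hk
  exact hk

def Good.toP (h : Good n R) : SetPartitionC n where
  blocks := (SetPartitionC.pmn n).image (cls n R)
  nonempty := by
    intro B hB
    obtain ⟨i, hi, rfl⟩ := Finset.mem_image.1 hB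
    exact ⟨i, by rw [mem_cls]; exact ⟨(mem_pmn n i).1 hi, sim_refl i⟩⟩
  disj := by
    intro B hB B' hB' hne
    obtain ⟨i, hi, rfl⟩ := Finset.mem_image.1 hB
    obtain ⟨j, hj, rfl⟩ := Finset.mem_image.1 hB'
    rw [Finset.disjoint_left]
    intro k hk hk'
    rw [mem_cls] at hk hk'
    exact hne (h.cls_eq (h.trans hk.2 hk'.2.symm))
  cover := by
    intro i
    rw [← inPm_iff]
    constructor
    · rintro ⟨B, hB, hi⟩
      obtain ⟨j, hj, rfl⟩ := Finset.mem_image.1 hB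
      exact ((mem_cls _ _).1 hi).1
    · intro hi
      exact ⟨cls n R i, Finset.mem_image_of_mem _ ((mem_pmn n i).2 hi),
        (mem_cls _ _).2 ⟨hi, sim_refl i⟩⟩
  symm := by
    intro B hB
    obtain ⟨i, hi, rfl⟩ := Finset.mem_image.1 hB
    rw [h.neg_cls]
    exact Finset.mem_image_of_mem _ ((mem_pmn n _).2 ((mem_pmn n i).1 hi).neg)
  zeroBlock := by
    intro B hB B' hB' e e'
    obtain ⟨i, hi, rfl⟩ := Finset.mem_image.1 hB
    obtain ⟨j, hj, rfl⟩ := Finset.mem_image.1 hB'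
    rw [h.neg_cls] at e e'
    obtain ⟨k, hk, hk2⟩ := h.zero ((mem_pmn n i).1 hi) e
    obtain ⟨l, hl, hl2⟩ := h.zero ((mem_pmn n j).1 hj) e'
    have := h.fx _ _ hk2 hl2
    subst this
    exact h.cls_eq (h.trans ((mem_cls _ _).1 hk).2 ((mem_cls _ _).1 hl).2.symm)

theorem Good.isArc (h : Good n R) (i j : ℤ) : h.toP.IsArc i j ↔ R i j := by
  constructor
  · rintro ⟨hlt, B, hB, hi, hj, hno⟩
    obtain ⟨b, hb, rfl⟩ := Finset.mem_image.1 hB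
    have hi' := (mem_cls _ _).1 hi
    have hj' := (mem_cls _ _).1 hj
    obtain ⟨k, hk, hk2⟩ := h.first (h.trans hi'.2.symm hj'.2) hlt
    have hkm := h.mem _ _ hk
    have hkc : k ∈ cls n R b := by
      rw [mem_cls]; exact ⟨hkm.2.1, h.trans hi'.2 (Or.inl (ReflTransGen.single hk))⟩
    have h1 := hno k hkc
    have h2 := h.le hk2
    have : k = j := ord_inj hkm.2.1 hj'.1 (by have := hkm.2.2; omega)
    rw [← this]; exact hk
  · intro hR
    have hm := h.mem _ _ hR
    refine ⟨hm.2.2, cls n R i, Finset.mem_image_of_mem _ ((mem_pmn n i).2 hm.1), ?_, ?_, ?_⟩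
    · rw [mem_cls]; exact ⟨hm.1, sim_refl i⟩
    · rw [mem_cls]; exact ⟨hm.2.1, Or.inl (ReflTransGen.single hR)⟩
    · rintro k hk ⟨h1, h2⟩
      rw [mem_cls] at hk
      obtain ⟨l, hl, hl2⟩ := h.first hk.2 h1
      have := h.ru _ _ _ hl hR
      subst this
      have := h.le hl2
      omega

end

/-! ### arcs of a partition -/
section
variable {n : ℕ}

theorem blk_mem (P : SetPartitionC n) {B : Finset ℤ} (hB : B ∈ P.blocks) {i : ℤ} (hi : i ∈ B) :
    InPm n i := by
  rw [inPm_iff]; exact (P.cover i).1 ⟨B, hB, hi⟩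

theorem blk_eq (P : SetPartitionC n) {B B' : Finset ℤ} (hB : B ∈ P.blocks) (hB' : B' ∈ P.blocks)
    {i : ℤ} (hi : i ∈ B) (hi' : i ∈ B') : B = B' := by
  by_contra hne
  exact Finset.disjoint_left.1 (P.disj B hB B' hB' hne) hi hi'

theorem arc_good (P : SetPartitionC n) : Good n P.IsArc where
  mem := by
    rintro i j ⟨hlt, B, hB, hi, hj, -⟩
    exact ⟨blk_mem P hB hi, blk_mem P hB hj, hlt⟩
  ru := by
    rintro i j k ⟨hlt, B, hB, hi, hj, hn⟩ ⟨hlt', B', hB', hi', hk, hn'⟩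
    have := blk_eq P hB hB' hi hi'
    subst this
    have h1 := hn k hk
    have h2 := hn' j hj
    exact ord_inj (blk_mem P hB hj) (blk_mem P hB hk) (by omega)
  lu := by
    rintro i j k ⟨hlt, B, hB, hi, hk, hn⟩ ⟨hlt', B', hB', hj, hk', hn'⟩
    have := blk_eq P hB hB' hk hk'
    subst this
    have h1 := hn j hj
    have h2 := hn' i hi
    exact ord_inj (blk_mem P hB hi) (blk_mem P hB hj) (by omega)
  sy := by
    rintro i j ⟨hlt, B, hB, hi, hj, hn⟩
    have mi := blk_mem P hB hi
    have mj := blk_mem P hB hj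
    refine ⟨?_, negSet B, P.symm B hB, ?_, ?_, ?_⟩
    · rw [ord_neg mi, ord_neg mj]; omega
    · rw [mem_negSet]; simpa using hj
    · rw [mem_negSet]; simpa using hi
    · intro k hk
      rw [mem_negSet] at hk
      have := hn _ hk
      have mk := blk_mem P hB hk
      have e := ord_neg mk
      rw [neg_neg] at e
      rw [ord_neg mi, ord_neg mj, e]
      omega
  fx := by
    have key : ∀ (B : Finset ℤ), B ∈ P.blocks → ∀ i, i ∈ B → -i ∈ B → negSet B = B := by
      intro B hB i hi hi'
      exact blk_eq P (P.symm B hB) hB (i := i) (by rw [mem_negSet]; exact hi') hi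
    rintro i k ⟨hlt, B, hB, hi, hi', hn⟩ ⟨hlt', B', hB', hk, hk', hn'⟩
    have := P.zeroBlock B hB B' hB' (key B hB i hi hi') (key B' hB' k hk hk')
    subst this
    have mi := blk_mem P hB hi
    have mk := blk_mem P hB hk
    have h1 := hn k hk
    have h2 := hn' i hi
    rw [ord_neg mi] at *
    rw [ord_neg mk] at *
    exact ord_inj mi mk (by omega)

theorem arc_in (P : SetPartitionC n) {B : Finset ℤ} (hB : B ∈ P.blocks) {i j : ℤ} (hi : i ∈ B)
    (hj : j ∈ B) (hlt : nestOrd n j < nestOrd n i) : ∃ k ∈ B, P.IsArc k i ∧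
      nestOrd n j ≤ nestOrd n k := by
  have hne : (B.filter fun k => nestOrd n k < nestOrd n i).Nonempty := ⟨j, by simp [hj, hlt]⟩
  obtain ⟨m, hm, hmax⟩ := Finset.exists_max_image _ (fun k => nestOrd n k) hne
  rw [Finset.mem_filter] at hm
  refine ⟨m, hm.1, ⟨hm.2, B, hB, hm.1, hi, ?_⟩, hmax j (by simp [hj, hlt])⟩
  rintro k hk ⟨h1, h2⟩
  have := hmax k (by simp [hk, h2])
  omega

theorem chain (P : SetPartitionC n) {B : Finset ℤ} (hB : B ∈ P.blocks) (d : ℕ) : ∀ {i j : ℤ}, i ∈ B →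
    j ∈ B → nestOrd n j - nestOrd n i ≤ d → nestOrd n i ≤ nestOrd n j →
    ReflTransGen P.IsArc i j := by
  induction d with
  | zero =>
    intro i j hi hj h1 h2
    have := ord_inj (blk_mem P hB hi) (blk_mem P hB hj) (by push_cast at h1; omega)
    rw [this]
  | succ d ih =>
    intro i j hi hj h1 h2
    rcases h2.eq_or_lt with e | e
    · rw [ord_inj (blk_mem P hB hi) (blk_mem P hB hj) e]
    · obtain ⟨k, hk, hk2, hk3⟩ := arc_in P hB hj hi e
      have := hk2.1
      push_cast at h1
      exact (ih hi hk (by omega) hk3).tail hk2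

theorem same_blk (P : SetPartitionC n) {B : Finset ℤ} (hB : B ∈ P.blocks) {i : ℤ} (hi : i ∈ B) :
    B = cls n P.IsArc i := by
  have key : ∀ a b, ReflTransGen P.IsArc a b → ((a ∈ B) ↔ (b ∈ B)) := by
    intro a b h
    induction h with
    | refl => rfl
    | tail _ h2 ih =>
      rw [ih]
      obtain ⟨-, B', hB', h3, h4, -⟩ := h2
      constructor
      · intro h; rw [blk_eq P hB hB' h h3]; exact h4
      · intro h; rw [blk_eq P hB hB' h h4]; exact h3
  ext j
  rw [mem_cls]
  constructor
  · intro hj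
    refine ⟨blk_mem P hB hj, ?_⟩
    rcases le_total (nestOrd n i) (nestOrd n j) with h | h
    · exact Or.inl (chain P hB _ hi hj (Int.self_le_toNat _) h)
    · exact Or.inr (chain P hB _ hj hi (Int.self_le_toNat _) h)
  · rintro ⟨-, h | h⟩
    · exact (key _ _ h).1 hi
    · exact (key _ _ h).2 hi

theorem blocks_eq (P : SetPartitionC n) :
    P.blocks = (SetPartitionC.pmn n).image (cls n P.IsArc) := by
  ext B
  rw [Finset.mem_image]
  constructor
  · intro hB
    obtain ⟨i, hi⟩ := P.nonempty B hB
    exact ⟨i, (mem_pmn n i).2 (blk_mem P hB hi), (same_blk P hB hi).symm⟩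
  · rintro ⟨i, hi, rfl⟩
    rw [mem_pmn, inPm_iff] at hi
    obtain ⟨B, hB, hiB⟩ := (P.cover i).2 hi
    rw [← same_blk P hB hiB]
    exact hB

theorem ext_arc (P Q : SetPartitionC n) (h : ∀ i j, P.IsArc i j ↔ Q.IsArc i j) : P = Q := by
  have e : P.IsArc = Q.IsArc := by funext i j; exact propext (h i j)
  have : P.blocks = Q.blocks := by rw [blocks_eq, blocks_eq, e]
  cases P; cases Q
  simp only at this
  subst this
  rfl

theorem mem_closers (P : SetPartitionC n) (i : ℤ) :
    i ∈ P.closers ↔ 0 < i ∧ ∃ k, P.IsArc k i := by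
  unfold SetPartitionC.closers
  rw [Finset.mem_filter, Finset.mem_Icc]
  constructor
  · rintro ⟨⟨h1, h2⟩, B, hB, hi, j, hj, hlt⟩
    obtain ⟨k, hk, hk2, -⟩ := arc_in P hB hi hj hlt
    exact ⟨by omega, k, hk2⟩
  · rintro ⟨h1, k, hlt, B, hB, hk, hi, -⟩
    have := (blk_mem P hB hi).2
    exact ⟨by omega, B, hB, hi, k, hk, hlt⟩

theorem mem_openers (P : SetPartitionC n) (i : ℤ) :
    i ∈ P.openers ↔ 0 < i ∧ ∃ k, P.IsArc i k := by
  unfold SetPartitionC.openers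
  rw [Finset.mem_filter, Finset.mem_Icc]
  constructor
  · rintro ⟨⟨h1, h2⟩, B, hB, hi, j, hj, hlt⟩
    have hB' := same_blk P hB hi
    rw [hB', mem_cls] at hj
    obtain ⟨k, hk, -⟩ := (arc_good P).first hj.2 hlt
    exact ⟨by omega, k, hk⟩
  · rintro ⟨h1, k, hlt, B, hB, hi, hk, -⟩
    have := (blk_mem P hB hi).2
    exact ⟨by omega, B, hB, hi, k, hk, hlt⟩

theorem mem_arcs (P : SetPartitionC n) (p : ℤ × ℤ) : p ∈ P.arcs ↔ P.IsArc p.1 p.2 := by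
  unfold SetPartitionC.arcs
  rw [Finset.mem_filter, Finset.mem_product, mem_pmn, mem_pmn]
  exact ⟨fun h => h.2, fun h => ⟨⟨((arc_good P).mem _ _ h).1, ((arc_good P).mem _ _ h).2.1⟩, h⟩⟩

end

/-! ### Part B: encoding -/

def V (O C : Finset ℤ) (σ : ℤ → ℤ) (m : ℤ) : Finset ℤ :=
  O.filter (fun i => i < m) \ (C.filter (fun j => j < m)).image σ

theorem mem_V (O C : Finset ℤ) (σ : ℤ → ℤ) (m i : ℤ) :
    i ∈ V O C σ m ↔ i ∈ O ∧ i < m ∧ ∀ j ∈ C, j < m → σ j ≠ i := by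
  unfold V
  simp only [Finset.mem_sdiff, Finset.mem_filter, Finset.mem_image, not_exists, not_and, and_assoc,
    and_imp, ne_eq]

structure Dat (n : ℕ) (O C : Finset ℤ) (σ τ : ℤ → ℤ) : Prop where
  hO : ∀ i ∈ O, 1 ≤ i ∧ i ≤ n
  hC : ∀ i ∈ C, 1 ≤ i ∧ i ≤ n
  hs : ∀ j ∈ C, σ j ∈ V O C σ j
  s0 : ∀ j, j ∉ C → σ j = 0
  ht : ∀ u ∈ V O C σ (n+1), τ u ∈ V O C σ (n+1)
  tt : ∀ u ∈ V O C σ (n+1), τ (τ u) = u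
  fx : ∀ u ∈ V O C σ (n+1), ∀ v ∈ V O C σ (n+1), τ u = u → τ v = v → u = v
  t0 : ∀ u, u ∉ V O C σ (n+1) → τ u = 0

def aR (n : ℕ) (O C : Finset ℤ) (σ τ : ℤ → ℤ) (i j : ℤ) : Prop :=
  (j ∈ C ∧ i = σ j) ∨ (-i ∈ C ∧ -j = σ (-i)) ∨ (i ∈ V O C σ (n+1) ∧ -j = τ i)

section
variable {n : ℕ} {O C : Finset ℤ} {σ τ : ℤ → ℤ}

theorem Dat.s (d : Dat n O C σ τ) {j : ℤ} (hj : j ∈ C) :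
    σ j ∈ O ∧ σ j < j ∧ 1 ≤ σ j ∧ 1 ≤ j ∧ j ≤ n := by
  have h := (mem_V _ _ _ _ _).1 (d.hs j hj)
  have h1 := d.hO _ h.1
  have h2 := d.hC _ hj
  exact ⟨h.1, h.2.1, h1.1, h2⟩

theorem Dat.inj (d : Dat n O C σ τ) {j k : ℤ} (hj : j ∈ C) (hk : k ∈ C) (e : σ j = σ k) :
    j = k := by
  have h1 := (mem_V _ _ _ _ _).1 (d.hs j hj)
  have h2 := (mem_V _ _ _ _ _).1 (d.hs k hk)
  rcases lt_trichotomy j k with h | h | h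
  · exact absurd e (h2.2.2 j hj h)
  · exact h
  · exact absurd e.symm (h1.2.2 k hk h)

theorem Dat.memU (d : Dat n O C σ τ) (i : ℤ) :
    i ∈ V O C σ (n+1) ↔ i ∈ O ∧ ∀ j ∈ C, σ j ≠ i := by
  rw [mem_V]
  constructor
  · rintro ⟨h1, h2, h3⟩
    refine ⟨h1, fun j hj => h3 j hj ?_⟩
    have := d.hC j hj; omega
  · rintro ⟨h1, h3⟩
    refine ⟨h1, ?_, fun j hj _ => h3 j hj⟩
    have := d.hO i h1; omega

theorem Dat.u (d : Dat n O C σ τ) {i : ℤ} (hi : i ∈ V O C σ (n+1)) :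
    i ∈ O ∧ 1 ≤ i ∧ i ≤ n := by
  have := (d.memU i).1 hi
  exact ⟨this.1, d.hO _ this.1⟩

theorem Dat.good (d : Dat n O C σ τ) : Good n (aR n O C σ τ) where
  mem := by
    rintro i j (⟨h, e⟩ | ⟨h, e⟩ | ⟨h, e⟩)
    · have := d.s h
      unfold InPm
      rw [ord_pos (i := i) (by omega), ord_pos (i := j) (by omega)]; omega
    · have := d.s h
      unfold InPm
      rw [ord_npos (i := i) (by omega), ord_npos (i := j) (by omega)]; omega
    · have h1 := d.u h
      have h2 := d.u (d.ht _ h)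
      unfold InPm
      rw [ord_pos (i := i) (by omega), ord_npos (i := j) (by omega)]; omega
  ru := by
    rintro i j k (⟨h, e⟩ | ⟨h, e⟩ | ⟨h, e⟩) (⟨h', e'⟩ | ⟨h', e'⟩ | ⟨h', e'⟩)
    · exact d.inj h h' (by omega)
    · have := d.s h; have := d.s h'; omega
    · exact absurd e.symm (((d.memU i).1 h').2 _ h)
    · have := d.s h; have := d.s h'; omega
    · omega
    · have := d.s h; have := d.u h'; omega
    · exact absurd e'.symm (((d.memU i).1 h).2 _ h')
    · have := d.s h'; have := d.u h; omega
    · omega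
  lu := by
    rintro i j k (⟨h, e⟩ | ⟨h, e⟩ | ⟨h, e⟩) (⟨h', e'⟩ | ⟨h', e'⟩ | ⟨h', e'⟩)
    · omega
    · have := d.s h; have := d.s h'; omega
    · have := d.s h; have := d.u (d.ht _ h'); omega
    · have := d.s h; have := d.s h'; omega
    · have := d.inj h h' (by omega); omega
    · exact absurd (by omega) (((d.memU _).1 (d.ht _ h')).2 _ h)
    · have := d.s h'; have := d.u (d.ht _ h); omega
    · exact absurd (by omega) (((d.memU _).1 (d.ht _ h)).2 _ h')
    · rw [← d.tt i h, ← d.tt j h', ← e, ← e']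
  sy := by
    rintro i j (⟨h, e⟩ | ⟨h, e⟩ | ⟨h, e⟩)
    · right; left; simpa using ⟨h, e⟩
    · left; exact ⟨h, e⟩
    · right; right
      rw [e]
      exact ⟨d.ht _ h, by rw [d.tt _ h]; simp⟩
  fx := by
    have key : ∀ i, aR n O C σ τ i (-i) → i ∈ V O C σ (n+1) ∧ τ i = i := by
      rintro i (⟨h, e⟩ | ⟨h, e⟩ | ⟨h, e⟩)
      · have := d.s h; omega
      · have := d.s h; omega
      · exact ⟨h, by omega⟩
    intro i k h h'
    exact d.fx _ (key i h).1 _ (key k h').1 (key i h).2 (key k h').2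

def Enc (P : SetPartitionC n) (σ τ : ℤ → ℤ) : Prop :=
  Dat n P.openers P.closers σ τ ∧ ∀ i j, P.IsArc i j ↔ aR n P.openers P.closers σ τ i j

theorem realize (d : Dat n O C σ τ) :
    ∃ Q : SetPartitionC n, Q.openers = O ∧ Q.closers = C ∧ Enc Q σ τ := by
  have ho : d.good.toP.openers = O := by
    ext i
    rw [mem_openers]
    constructor
    · rintro ⟨h0, k, hk⟩
      rw [Good.isArc] at hk
      rcases hk with ⟨h, e⟩ | ⟨h, e⟩ | ⟨h, e⟩
      · rw [e]; exact (d.s h).1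
      · have := d.s h; omega
      · exact (d.u h).1
    · intro hi
      refine ⟨by have := d.hO i hi; omega, ?_⟩
      by_cases h : ∃ j ∈ C, σ j = i
      · obtain ⟨j, hj, e⟩ := h
        exact ⟨j, by rw [Good.isArc]; exact Or.inl ⟨hj, e.symm⟩⟩
      · push Not at h
        refine ⟨- τ i, ?_⟩
        rw [Good.isArc]
        exact Or.inr (Or.inr ⟨(d.memU i).2 ⟨hi, h⟩, by simp⟩)
  have hc : d.good.toP.closers = C := by
    ext i
    rw [mem_closers]
    constructor
    · rintro ⟨h0, k, hk⟩
      rw [Good.isArc] at hk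
      rcases hk with ⟨h, e⟩ | ⟨h, e⟩ | ⟨h, e⟩
      · exact h
      · have := d.s h; omega
      · have := d.u (d.ht _ h); omega
    · intro hi
      refine ⟨by have := d.hC i hi; omega, σ i, ?_⟩
      rw [Good.isArc]; exact Or.inl ⟨hi, rfl⟩
  refine ⟨d.good.toP, ho, hc, ?_⟩
  unfold Enc
  rw [ho, hc]
  exact ⟨d, fun i j => Good.isArc _ i j⟩

theorem extract (P : SetPartitionC n) : ∃ σ τ, Enc P σ τ := by
  have g := arc_good P
  have hc : ∀ j : ℤ, ∃ i, if j ∈ P.closers then P.IsArc i j else i = 0 := by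
    intro j
    split_ifs with h
    · exact ((mem_closers P j).1 h).2
    · exact ⟨0, rfl⟩
  choose σ hσ using hc
  have hσ1 : ∀ j ∈ P.closers, P.IsArc (σ j) j := by
    intro j hj; have := hσ j; rwa [if_pos hj] at this
  have hσ0 : ∀ j, j ∉ P.closers → σ j = 0 := by
    intro j hj; have := hσ j; rwa [if_neg hj] at this
  have hO : ∀ i ∈ P.openers, 1 ≤ i ∧ i ≤ n := by
    intro i hi
    obtain ⟨h1, k, hk⟩ := (mem_openers P i).1 hi
    have := (g.mem _ _ hk).1.2.2
    omega
  have hC : ∀ i ∈ P.closers, 1 ≤ i ∧ i ≤ n := by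
    intro i hi
    obtain ⟨h1, k, hk⟩ := (mem_closers P i).1 hi
    have := (g.mem _ _ hk).2.1.2.2
    omega
  have hlt : ∀ i j, P.IsArc i j → 0 < j → 0 < i ∧ i < j := by
    intro i j h h0
    have h1 := g.mem _ _ h
    have h2 := h1.1.2
    have h3 := h1.2.1.2
    have h4 := h1.2.2
    rw [ord_pos h0] at h4
    by_cases hi : 0 < i
    · rw [ord_pos hi] at h4; exact ⟨hi, h4⟩
    · rw [ord_npos hi] at h4; omega
  have hs : ∀ j ∈ P.closers, σ j ∈ V P.openers P.closers σ j := by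
    intro j hj
    have ha := hσ1 j hj
    have hl := hlt _ _ ha (by have := hC j hj; omega)
    rw [mem_V]
    refine ⟨(mem_openers P _).2 ⟨hl.1, j, ha⟩, hl.2, ?_⟩
    intro k hk hkj e
    have hb := hσ1 k hk
    rw [e] at hb
    have := g.ru _ _ _ ha hb
    omega
  have memU : ∀ i, i ∈ V P.openers P.closers σ (n+1) ↔ ∃ k, 0 < i ∧ 0 < k ∧ P.IsArc i (-k) := by
    intro i
    rw [mem_V, mem_openers]
    constructor
    · rintro ⟨⟨h0, k, hk⟩, -, h3⟩
      refine ⟨-k, h0, ?_, by simpa using hk⟩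
      by_contra hk0
      have hm := (g.mem _ _ hk).2.1
      have : 0 < k := by have := hm.1; omega
      have hkc : k ∈ P.closers := (mem_closers P k).2 ⟨this, i, hk⟩
      exact h3 k hkc (by have := hm.2; omega) (g.lu _ _ _ (hσ1 k hkc) hk)
    · rintro ⟨k, h0, hk0, hk⟩
      refine ⟨⟨h0, _, hk⟩, by have := (g.mem _ _ hk).1.2; omega, ?_⟩
      rintro j hj - e
      have hb := hσ1 j hj
      rw [e] at hb
      have := g.ru _ _ _ hk hb
      have := hC j hj
      omega
  have ht : ∀ i : ℤ, ∃ k, if i ∈ V P.openers P.closers σ (n+1) then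
      0 < i ∧ 0 < k ∧ P.IsArc i (-k) else k = 0 := by
    intro i
    split_ifs with h
    · exact (memU i).1 h
    · exact ⟨0, rfl⟩
  choose τ hτ using ht
  have hτ1 : ∀ i ∈ V P.openers P.closers σ (n+1), 0 < i ∧ 0 < τ i ∧ P.IsArc i (-τ i) := by
    intro j hj; have := hτ j; rwa [if_pos hj] at this
  have hτ0 : ∀ j, j ∉ V P.openers P.closers σ (n+1) → τ j = 0 := by
    intro j hj; have := hτ j; rwa [if_neg hj] at this
  have htU : ∀ u ∈ V P.openers P.closers σ (n+1), τ u ∈ V P.openers P.closers σ (n+1) := by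
    intro u hu
    obtain ⟨h1, h2, h3⟩ := hτ1 u hu
    rw [memU]
    exact ⟨u, h2, h1, by simpa using g.sy _ _ h3⟩
  refine ⟨σ, τ, ⟨hO, hC, hs, hσ0, htU, ?_, ?_, hτ0⟩, ?_⟩
  · intro u hu
    have h1 := hτ1 u hu
    have h2 := hτ1 _ (htU u hu)
    have h3 := g.sy _ _ h1.2.2
    rw [neg_neg] at h3
    have := g.ru _ _ _ h3 h2.2.2
    omega
  · intro u hu v hv e e'
    have h1 := (hτ1 u hu).2.2
    have h2 := (hτ1 v hv).2.2
    rw [e] at h1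
    rw [e'] at h2
    exact g.fx _ _ h1 h2
  · intro i j
    constructor
    · intro h
      have hm := g.mem _ _ h
      by_cases hj : 0 < j
      · left
        have hjc : j ∈ P.closers := (mem_closers P j).2 ⟨hj, i, h⟩
        exact ⟨hjc, g.lu _ _ _ h (hσ1 j hjc)⟩
      · right
        by_cases hi : 0 < i
        · right
          have hjn : 0 < -j := by have := hm.2.1.1; omega
          have hu : i ∈ V P.openers P.closers σ (n+1) :=
            (memU i).2 ⟨-j, hi, hjn, by simpa using h⟩
          refine ⟨hu, ?_⟩
          have := g.ru _ _ _ h (hτ1 i hu).2.2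
          omega
        · left
          have hin : 0 < -i := by have := hm.1.1; omega
          have h' := g.sy _ _ h
          have hic : -i ∈ P.closers := (mem_closers P _).2 ⟨hin, _, h'⟩
          exact ⟨hic, g.lu _ _ _ h' (hσ1 _ hic)⟩
    · rintro (⟨h, e⟩ | ⟨h, e⟩ | ⟨h, e⟩)
      · rw [e]; exact hσ1 j h
      · have := g.sy _ _ (hσ1 _ h)
        rw [← e] at this; simpa using this
      · have := (hτ1 i h).2.2
        rw [← e] at this; simpa using this

theorem Enc.uniq {P : SetPartitionC n} {σ τ σ' τ' : ℤ → ℤ} (h : Enc P σ τ) (h' : Enc P σ' τ') :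
    σ = σ' ∧ τ = τ' := by
  have g := arc_good P
  have e : σ = σ' := by
    funext j
    by_cases hj : j ∈ P.closers
    · exact g.lu _ _ j ((h.2 _ _).2 (Or.inl ⟨hj, rfl⟩)) ((h'.2 _ _).2 (Or.inl ⟨hj, rfl⟩))
    · rw [h.1.s0 j hj, h'.1.s0 j hj]
  subst e
  refine ⟨rfl, ?_⟩
  funext j
  by_cases hj : j ∈ V P.openers P.closers σ (n+1)
  · have := g.ru j _ _ ((h.2 j (-τ j)).2 (Or.inr (Or.inr ⟨hj, by simp⟩)))
      ((h'.2 j (-τ' j)).2 (Or.inr (Or.inr ⟨hj, by simp⟩)))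
    omega
  · rw [h.1.t0 j hj, h'.1.t0 j hj]

end

/-! ### Part C: the linking of codes -/

def rk (U : Finset ℤ) (x : ℤ) : ℕ := (U.filter (fun y => y < x)).card

theorem rk_mono (U : Finset ℤ) {x y : ℤ} (h : x ≤ y) : rk U x ≤ rk U y := by
  apply Finset.card_le_card
  intro z hz
  rw [Finset.mem_filter] at *
  exact ⟨hz.1, hz.2.trans_le h⟩

theorem rk_lt (U : Finset ℤ) {x y : ℤ} (hx : x ∈ U) (h : x < y) : rk U x < rk U y := by
  apply Finset.card_lt_card
  rw [Finset.ssubset_iff_of_subset]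
  · exact ⟨x, by simp [hx, h], by simp⟩
  · intro z hz
    rw [Finset.mem_filter] at *
    exact ⟨hz.1, hz.2.trans h⟩

theorem rk_lt_iff (U : Finset ℤ) {x y : ℤ} (hx : x ∈ U) : rk U x < rk U y ↔ x < y := by
  refine ⟨fun h => ?_, rk_lt U hx⟩
  by_contra h'
  have := rk_mono U (not_lt.1 h')
  omega

theorem rk_inj (U : Finset ℤ) {x y : ℤ} (hx : x ∈ U) (hy : y ∈ U) (h : rk U x = rk U y) :
    x = y := by
  rcases lt_trichotomy x y with h1 | h1 | h1
  · have := rk_lt U hx h1; omega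
  · exact h1
  · have := rk_lt U hy h1; omega

theorem rk_lt_card (U : Finset ℤ) {x : ℤ} (hx : x ∈ U) : rk U x < U.card := by
  apply Finset.card_lt_card
  rw [Finset.ssubset_iff_of_subset (Finset.filter_subset _ _)]
  exact ⟨x, hx, by simp⟩

theorem rk_ex (U : Finset ℤ) {k : ℕ} (hk : k < U.card) : ∃ x ∈ U, rk U x = k := by
  have : U.image (rk U) = Finset.range U.card := by
    apply Finset.eq_of_subset_of_card_le
    · intro k hk
      obtain ⟨x, hx, rfl⟩ := Finset.mem_image.1 hk
      exact Finset.mem_range.2 (rk_lt_card U hx)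
    · rw [Finset.card_range, Finset.card_image_of_injOn]
      intro x hx y hy h
      exact rk_inj U hx hy h
  have h2 : k ∈ U.image (rk U) := by rw [this]; exact Finset.mem_range.2 hk
  simpa using h2

section
variable {n : ℕ} {O C : Finset ℤ} {σ τ σ' τ' : ℤ → ℤ}

theorem card_V {m : ℤ} (h : ∀ j ∈ C, j < m → σ j ∈ V O C σ j) :
    (V O C σ m).card + (C.filter (fun j => j < m)).card = (O.filter (fun j => j < m)).card := by
  have hsub : (C.filter (fun j => j < m)).image σ ⊆ O.filter (fun i => i < m) := by
    intro x hx
    obtain ⟨j, hj, rfl⟩ := Finset.mem_image.1 hx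
    rw [Finset.mem_filter] at hj
    have := (mem_V _ _ _ _ _).1 (h j hj.1 hj.2)
    rw [Finset.mem_filter]
    exact ⟨this.1, this.2.1.trans hj.2⟩
  have hc : ((C.filter (fun j => j < m)).image σ).card = (C.filter (fun j => j < m)).card := by
    apply Finset.card_image_of_injOn
    intro j hj k hk e
    simp only [Finset.coe_filter, Set.mem_ofPred_eq] at hj hk
    have h1 := (mem_V _ _ _ _ _).1 (h j hj.1 hj.2)
    have h2 := (mem_V _ _ _ _ _).1 (h k hk.1 hk.2)
    rcases lt_trichotomy j k with h | h | h
    · exact absurd e (h2.2.2 j hj.1 h)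
    · exact h
    · exact absurd e.symm (h1.2.2 k hk.1 h)
  unfold V
  rw [← hc]
  exact Finset.card_sdiff_add_card_eq_card hsub

theorem V_congr {m : ℤ} (h : ∀ j ∈ C, j < m → σ j = σ' j) : V O C σ m = V O C σ' m := by
  ext i
  rw [mem_V, mem_V]
  constructor
  · rintro ⟨a, b, c⟩
    exact ⟨a, b, fun j hj hjm => by rw [← h j hj hjm]; exact c j hj hjm⟩
  · rintro ⟨a, b, c⟩
    exact ⟨a, b, fun j hj hjm => by rw [h j hj hjm]; exact c j hj hjm⟩

structure Link (n : ℕ) (O C : Finset ℤ) (σ τ σ' τ' : ℤ → ℤ) : Prop where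
  l1 : ∀ j ∈ C, rk (V O C σ' j) (σ' j) + rk (V O C σ j) (σ j) + 1 = (V O C σ j).card
  l2 : ∀ u ∈ V O C σ (n+1), ∀ u' ∈ V O C σ' (n+1),
    rk (V O C σ (n+1)) u = rk (V O C σ' (n+1)) u' →
    rk (V O C σ (n+1)) (τ u) = rk (V O C σ' (n+1)) (τ' u')

theorem Dat.card_eq (d : Dat n O C σ τ) (d' : Dat n O C σ' τ') (m : ℤ) :
    (V O C σ m).card = (V O C σ' m).card := by
  have h1 := card_V (O := O) (m := m) (fun j hj _ => d.hs j hj)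
  have h2 := card_V (O := O) (m := m) (fun j hj _ => d'.hs j hj)
  omega

theorem Link.symm (d : Dat n O C σ τ) (d' : Dat n O C σ' τ') (l : Link n O C σ τ σ' τ') :
    Link n O C σ' τ' σ τ where
  l1 := by
    intro j hj
    have := l.l1 j hj
    rw [← d.card_eq d' j]; omega
  l2 := by
    intro u hu u' hu' e
    exact (l.l2 u' hu' u hu e.symm).symm

theorem ex_sigma (hC : ∀ i ∈ C, 1 ≤ i ∧ i ≤ n) (hs : ∀ j ∈ C, σ j ∈ V O C σ j) (m : ℕ) :
    ∃ σ' : ℤ → ℤ, (∀ j, j ∉ C → σ' j = 0) ∧ ∀ j ∈ C, j < m → σ' j ∈ V O C σ' j ∧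
      rk (V O C σ' j) (σ' j) + rk (V O C σ j) (σ j) + 1 = (V O C σ j).card := by
  induction m with
  | zero =>
    refine ⟨fun _ => 0, fun _ _ => rfl, fun j hj hlt => ?_⟩
    have := hC j hj
    push_cast at hlt; omega
  | succ m ih =>
    obtain ⟨s, s0, hs'⟩ := ih
    by_cases hm : (m:ℤ) ∈ C
    · have hcard : (V O C σ m).card = (V O C s m).card := by
        have h1 := card_V (O := O) (m := m) (fun j hj _ => hs j hj)
        have h2 := card_V (O := O) (m := m) (fun j hj h => (hs' j hj h).1)
        omega
      have hr := rk_lt_card _ (hs m hm)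
      obtain ⟨x, hx, hxr⟩ := rk_ex (V O C s m)
        (k := (V O C σ m).card - 1 - rk (V O C σ m) (σ m)) (by omega)
      have hV : ∀ j : ℤ, j ≤ m → V O C (Function.update s m x) j = V O C s j := by
        intro j hj
        apply V_congr
        intro k hk hkj
        rw [Function.update_of_ne (by omega)]
      refine ⟨Function.update s m x, ?_, ?_⟩
      · intro j hj
        rw [Function.update_of_ne (by rintro rfl; exact hj hm)]
        exact s0 j hj
      · intro j hj hlt
        push_cast at hlt
        rw [hV j (by omega)]
        by_cases e : j = m
        · subst e
          rw [Function.update_self]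
          exact ⟨hx, by omega⟩
        · rw [Function.update_of_ne e]
          exact hs' j hj (by omega)
    · refine ⟨s, s0, fun j hj hlt => hs' j hj ?_⟩
      push_cast at hlt
      have : j ≠ m := by rintro rfl; exact hm hj
      omega

theorem ex_e {U U' : Finset ℤ} (h : U.card = U'.card) :
    ∃ e : ℤ → ℤ, ∀ u ∈ U, e u ∈ U' ∧ rk U' (e u) = rk U u := by
  have : ∀ u, ∃ x, u ∈ U → x ∈ U' ∧ rk U' x = rk U u := by
    intro u
    by_cases hu : u ∈ U
    · obtain ⟨x, hx, hx'⟩ := rk_ex U' (k := rk U u) (by rw [← h]; exact rk_lt_card U hu)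
      exact ⟨x, fun _ => ⟨hx, hx'⟩⟩
    · exact ⟨0, fun h => absurd h hu⟩
  choose e he using this
  exact ⟨e, he⟩

theorem ex_link (d : Dat n O C σ τ) : ∃ σ' τ', Dat n O C σ' τ' ∧ Link n O C σ τ σ' τ' := by
  obtain ⟨s, s0, hs⟩ := ex_sigma d.hC d.hs (n+1)
  have hlt : ∀ j ∈ C, j < ((n+1 : ℕ) : ℤ) := by
    intro j hj; have := d.hC j hj; push_cast; omega
  have hs1 : ∀ j ∈ C, s j ∈ V O C s j := fun j hj => (hs j hj (hlt j hj)).1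
  have hcard : (V O C σ (n+1)).card = (V O C s (n+1)).card := by
    have h1 := card_V (O := O) (m := n+1) (fun j hj _ => d.hs j hj)
    have h2 := card_V (O := O) (m := n+1) (fun j hj h => hs1 j hj)
    omega
  have ht := d.ht
  have tt := d.tt
  have fx := d.fx
  set U := V O C σ (n+1) with hU
  set U' := V O C s (n+1) with hU'
  obtain ⟨e, he⟩ := ex_e hcard
  obtain ⟨f, hf⟩ := ex_e hcard.symm
  have hfe : ∀ u ∈ U, f (e u) = u := by
    intro u hu
    have h1 := he u hu
    have h2 := hf _ h1.1
    exact rk_inj U h2.1 hu (by omega)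
  have hef : ∀ u ∈ U', e (f u) = u := by
    intro u hu
    have h1 := hf u hu
    have h2 := he _ h1.1
    exact rk_inj U' h2.1 hu (by omega)
  obtain ⟨t, ht1, ht0⟩ : ∃ t : ℤ → ℤ, (∀ u ∈ U', t u = e (τ (f u))) ∧ ∀ u, u ∉ U' → t u = 0 :=
    ⟨fun u => if u ∈ U' then e (τ (f u)) else 0, fun u hu => if_pos hu, fun u hu => if_neg hu⟩
  have hmem : ∀ u ∈ U', e (τ (f u)) ∈ U' := fun u hu => (he _ (ht _ (hf u hu).1)).1
  refine ⟨s, t,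
    ⟨d.hO, d.hC, hs1, s0, ?_, ?_, ?_, ?_⟩, ⟨?_, ?_⟩⟩
  · intro u hu
    rw [ht1 u hu]; exact hmem u hu
  · intro u hu
    rw [ht1 u hu, ht1 _ (hmem u hu), hfe _ (ht _ (hf u hu).1), tt _ (hf u hu).1, hef u hu]
  · intro u hu v hv h1 h2
    rw [ht1 u hu] at h1
    rw [ht1 v hv] at h2
    have h3 := hfe _ (ht _ (hf u hu).1)
    have h4 := hfe _ (ht _ (hf v hv).1)
    rw [h1] at h3
    rw [h2] at h4
    have := fx _ (hf u hu).1 _ (hf v hv).1 h3.symm h4.symm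
    rw [← hef u hu, ← hef v hv, this]
  · exact ht0
  · intro j hj
    exact (hs j hj (hlt j hj)).2
  · intro u hu u' hu' h
    rw [ht1 u' hu']
    have h1 := hf u' hu'
    have : f u' = u := rk_inj U h1.1 hu (by rw [h1.2]; exact h.symm)
    rw [this]
    exact (he _ (ht u hu)).2.symm

theorem link_uniq {σ₁ τ₁ σ₂ τ₂ : ℤ → ℤ} (d : Dat n O C σ τ) (d₁ : Dat n O C σ₁ τ₁)
    (d₂ : Dat n O C σ₂ τ₂) (l₁ : Link n O C σ τ σ₁ τ₁) (l₂ : Link n O C σ τ σ₂ τ₂) :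
    σ₁ = σ₂ ∧ τ₁ = τ₂ := by
  have key : ∀ m : ℕ, ∀ j ∈ C, j < m → σ₁ j = σ₂ j := by
    intro m
    induction m with
    | zero =>
      intro j hj hlt
      have := d.hC j hj
      push_cast at hlt; omega
    | succ m ih =>
      intro j hj hlt
      push_cast at hlt
      have hV : V O C σ₁ j = V O C σ₂ j := V_congr (fun k hk hkj => ih k hk (by omega))
      have h1 := l₁.l1 j hj
      have h2 := l₂.l1 j hj
      have h3 := d₁.hs j hj
      rw [hV] at h1 h3
      exact rk_inj _ h3 (d₂.hs j hj) (by omega)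
  have es : σ₁ = σ₂ := by
    funext j
    by_cases hj : j ∈ C
    · exact key (n+1) j hj (by have := d.hC j hj; push_cast; omega)
    · rw [d₁.s0 j hj, d₂.s0 j hj]
  subst es
  refine ⟨rfl, ?_⟩
  funext u
  by_cases hu : u ∈ V O C σ₁ (n+1)
  · obtain ⟨x, hx, hxr⟩ := rk_ex (V O C σ (n+1)) (k := rk (V O C σ₁ (n+1)) u)
      (by rw [d.card_eq d₁]; exact rk_lt_card _ hu)
    have h1 := l₁.l2 x hx u hu hxr
    have h2 := l₂.l2 x hx u hu hxr
    exact rk_inj _ (d₁.ht u hu) (d₂.ht u hu) (by omega)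
  · rw [d₁.t0 u hu, d₂.t0 u hu]

def XX (U : Finset ℤ) (τ : ℤ → ℤ) : ℕ :=
  ∑ u ∈ U, ∑ v ∈ U, if u < v ∧ τ u < τ v then 1 else 0

theorem link_XX (d : Dat n O C σ τ) (d' : Dat n O C σ' τ') (l : Link n O C σ τ σ' τ') :
    XX (V O C σ (n+1)) τ = XX (V O C σ' (n+1)) τ' := by
  obtain ⟨e, he⟩ := ex_e (d.card_eq d' (n+1))
  obtain ⟨f, hf⟩ := ex_e (d.card_eq d' (n+1)).symm
  have ht := d.ht
  have ht' := d'.ht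
  have l2 := l.l2
  set U := V O C σ (n+1) with hU
  set U' := V O C σ' (n+1) with hU'
  have hfe : ∀ u ∈ U, f (e u) = u := by
    intro u hu
    have h1 := he u hu
    have h2 := hf _ h1.1
    exact rk_inj U h2.1 hu (by omega)
  have hef : ∀ u ∈ U', e (f u) = u := by
    intro u hu
    have h1 := hf u hu
    have h2 := he _ h1.1
    exact rk_inj U' h2.1 hu (by omega)
  have sum : ∀ (F G : ℤ → ℕ), (∀ u ∈ U, F u = G (e u)) → ∑ u ∈ U, F u = ∑ u ∈ U', G u := by
    intro F G h
    exact Finset.sum_nbij' e f (fun u hu => (he u hu).1) (fun u hu => (hf u hu).1) hfe hef h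
  unfold XX
  apply sum
  intro u hu
  apply sum
  intro v hv
  have h1 := l2 u hu (e u) (he u hu).1 (he u hu).2.symm
  have h2 := l2 v hv (e v) (he v hv).1 (he v hv).2.symm
  have e1 : (u < v) ↔ (e u < e v) := by
    rw [← rk_lt_iff U hu, ← rk_lt_iff U' (he u hu).1, (he u hu).2, (he v hv).2]
  have e2 : (τ u < τ v) ↔ (τ' (e u) < τ' (e v)) := by
    rw [← rk_lt_iff U (ht u hu), ← rk_lt_iff U' (ht' _ (he u hu).1), h1, h2]
  simp only [e1, e2]

end

/-! ### Part D: statistics -/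
section
variable {n : ℕ} {O C : Finset ℤ} {σ τ σ' τ' : ℤ → ℤ}

theorem Dat.card_filter (d : Dat n O C σ τ) {j : ℤ} (hj : j ∈ C) (p : ℤ → Prop)
    (hp : ¬ p (σ j)) :
    ((V O C σ j).filter p).card = (∑ k ∈ C, if p (σ k) ∧ σ k < j ∧ j < k then 1 else 0) +
      ∑ u ∈ V O C σ (n+1), if p u ∧ u < j then 1 else 0 := by
  rw [← Finset.card_filter, ← Finset.card_filter]
  have hi : (C.filter (fun k => p (σ k) ∧ σ k < j ∧ j < k)).card =
      ((C.filter (fun k => p (σ k) ∧ σ k < j ∧ j < k)).image σ).card := by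
    rw [Finset.card_image_of_injOn]
    intro a ha b hb e
    simp only [Finset.coe_filter, Set.mem_ofPred_eq] at ha hb
    exact d.inj ha.1 hb.1 e
  rw [hi, ← Finset.card_union_of_disjoint]
  · congr 1
    ext i
    simp only [Finset.mem_filter, Finset.mem_union, Finset.mem_image]
    constructor
    · rintro ⟨hV, hpi⟩
      rw [mem_V] at hV
      by_cases h : ∃ k ∈ C, σ k = i
      · obtain ⟨k, hk, rfl⟩ := h
        left
        refine ⟨k, ⟨hk, hpi, hV.2.1, ?_⟩, rfl⟩
        rcases lt_trichotomy j k with h | h | h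
        · exact h
        · subst h; exact absurd hpi hp
        · exact absurd rfl (hV.2.2 k hk h)
      · right
        push Not at h
        exact ⟨(d.memU i).2 ⟨hV.1, h⟩, hpi, hV.2.1⟩
    · rintro (⟨k, ⟨hk, hpi, h1, h2⟩, rfl⟩ | ⟨hu, hpi, h1⟩)
      · refine ⟨?_, hpi⟩
        rw [mem_V]
        refine ⟨(d.s hk).1, h1, fun l hl hlj e => ?_⟩
        have := d.inj hl hk e
        omega
      · refine ⟨?_, hpi⟩
        rw [mem_V]
        have := (d.memU i).1 hu
        exact ⟨this.1, h1, fun l hl _ => this.2 l hl⟩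
  · rw [Finset.disjoint_left]
    intro i h1 h2
    obtain ⟨k, hk, rfl⟩ := Finset.mem_image.1 h1
    rw [Finset.mem_filter] at hk h2
    exact ((d.memU _).1 h2.1).2 k hk.1 rfl

def ab (n : ℕ) (O C : Finset ℤ) (σ : ℤ → ℤ) (j : ℤ) : ℕ :=
  (∑ k ∈ C, if σ j < σ k ∧ σ k < j ∧ j < k then 1 else 0) +
      ∑ u ∈ V O C σ (n+1), if σ j < u ∧ u < j then 1 else 0

def be (n : ℕ) (O C : Finset ℤ) (σ : ℤ → ℤ) (j : ℤ) : ℕ :=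
  (∑ k ∈ C, if σ k < σ j ∧ σ k < j ∧ j < k then 1 else 0) +
      ∑ u ∈ V O C σ (n+1), if u < σ j ∧ u < j then 1 else 0

theorem Dat.be_eq (d : Dat n O C σ τ) {j : ℤ} (hj : j ∈ C) :
    be n O C σ j = rk (V O C σ j) (σ j) := by
  unfold be rk
  convert (d.card_filter hj (fun i => i < σ j) (lt_irrefl _)).symm

theorem Dat.ab_eq (d : Dat n O C σ τ) {j : ℤ} (hj : j ∈ C) :
    ab n O C σ j + rk (V O C σ j) (σ j) + 1 = (V O C σ j).card := by
  have h1 : ab n O C σ j = ((V O C σ j).filter (fun i => σ j < i)).card := by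
    unfold ab
    convert (d.card_filter hj (fun i => σ j < i) (lt_irrefl _)).symm
  have h2 := Finset.card_filter_add_card_filter_not (s := V O C σ j) (fun i => i < σ j)
  have h3 : (V O C σ j).filter (fun i => ¬ i < σ j) =
      insert (σ j) ((V O C σ j).filter (fun i => σ j < i)) := by
    ext i
    simp only [Finset.mem_filter, Finset.mem_insert]
    constructor
    · rintro ⟨h, h'⟩
      rcases (not_lt.1 h').eq_or_lt with e | e
      · left; exact e.symm
      · right; exact ⟨h, e⟩
    · rintro (e | ⟨h, h'⟩)
      · rw [e]; exact ⟨d.hs j hj, lt_irrefl _⟩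
      · exact ⟨h, by omega⟩
  rw [h3, Finset.card_insert_of_notMem (by simp), ← h1] at h2
  unfold rk
  omega

theorem sum_arcs {P : SetPartitionC n} (h : Enc P σ τ) (f : ℤ × ℤ → ℕ) :
    ∑ p ∈ P.arcs, f p = ∑ j ∈ P.closers, f (σ j, j) + ∑ j ∈ P.closers, f (-j, -σ j) +
      ∑ u ∈ V P.openers P.closers σ (n+1), f (u, -τ u) := by
  obtain ⟨d, hP⟩ := h
  have e : P.arcs = (P.closers.image (fun j => (σ j, j)) ∪ P.closers.image (fun j => (-j, -σ j)))
      ∪ (V P.openers P.closers σ (n+1)).image (fun u => (u, -τ u)) := by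
    ext ⟨i, j⟩
    rw [mem_arcs, hP]
    simp only [Finset.mem_union, Finset.mem_image, Prod.mk.injEq, or_assoc, aR]
    refine or_congr ?_ (or_congr ?_ ?_)
    · constructor
      · rintro ⟨a, b⟩; exact ⟨j, a, b.symm, rfl⟩
      · rintro ⟨k, a, b, rfl⟩; exact ⟨a, b.symm⟩
    · constructor
      · rintro ⟨a, b⟩; exact ⟨-i, a, by simp, by omega⟩
      · rintro ⟨k, a, rfl, rfl⟩; simpa using a
    · constructor
      · rintro ⟨a, b⟩; exact ⟨i, a, rfl, by omega⟩
      · rintro ⟨k, a, rfl, rfl⟩; simpa using a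
  rw [e, Finset.sum_union, Finset.sum_union, Finset.sum_image, Finset.sum_image, Finset.sum_image]
  · intro a _ b _ h; exact (Prod.mk.inj h).1
  · intro a _ b _ h; exact neg_injective (Prod.mk.inj h).1
  · intro a _ b _ h; exact (Prod.mk.inj h).2
  · rw [Finset.disjoint_left]
    intro p h1 h2
    obtain ⟨j, hj, rfl⟩ := Finset.mem_image.1 h1
    obtain ⟨k, hk, e⟩ := Finset.mem_image.1 h2
    have e1 := (Prod.mk.inj e).1
    have := d.s hj; have := d.s hk; omega
  · rw [Finset.disjoint_left]
    intro p h1 h2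
    obtain ⟨k, hk, rfl⟩ := Finset.mem_image.1 h2
    have hu := d.u hk
    have hu' := d.u (d.ht _ hk)
    rw [Finset.mem_union, Finset.mem_image, Finset.mem_image] at h1
    rcases h1 with ⟨j, hj, e⟩ | ⟨j, hj, e⟩
    · have e1 := (Prod.mk.inj e).2
      have := d.s hj; omega
    · have e1 := (Prod.mk.inj e).1
      have := d.s hj; omega

theorem dbl {P : SetPartitionC n} (h : Enc P σ τ) (W : ℤ × ℤ → ℤ × ℤ → Prop) :
    ((P.arcs ×ˢ P.arcs).filter fun q => W q.1 q.2).card =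
    ∑ p ∈ P.arcs, ∑ q ∈ P.arcs, if W p q then 1 else 0 := by
  rw [Finset.card_filter, Finset.sum_product]

theorem Dat.reidx (d : Dat n O C σ τ) (F : ℤ → ℕ) :
    ∑ u ∈ V O C σ (n+1), F (τ u) = ∑ u ∈ V O C σ (n+1), F u :=
  Finset.sum_nbij' τ τ d.ht d.ht d.tt d.tt (fun _ _ => rfl)

theorem cross_eq {P : SetPartitionC n} (h : Enc P σ τ) :
    P.crossings = 2 * ∑ j ∈ P.closers, ab n P.openers P.closers σ j +
      XX (V P.openers P.closers σ (n+1)) τ := by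
  have d := h.1
  unfold SetPartitionC.crossings
  rw [dbl h (CrossRel n), sum_arcs h]
  have A1 : ∀ j ∈ P.closers, (∑ q ∈ P.arcs, if CrossRel n (σ j, j) q then 1 else 0) =
      ab n P.openers P.closers σ j := by
    intro j hj
    have sj := d.s hj
    rw [sum_arcs h]
    unfold ab
    have z : (∑ k ∈ P.closers, if CrossRel n (σ j, j) (-k, -σ k) then 1 else 0) = 0 := by
      apply Finset.sum_eq_zero
      intro k hk
      have sk := d.s hk
      rw [if_neg]
      simp only [CrossRel, cpr, crossOrd]
      split_ifs <;> omega
    rw [z, add_zero]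
    congr 1
    · apply Finset.sum_congr rfl
      intro k hk
      have sk := d.s hk
      congr 1
      apply propext
      simp only [CrossRel, cpr, crossOrd]
      split_ifs <;> omega
    · apply Finset.sum_congr rfl
      intro u hu
      have su := d.u hu
      have tu := d.u (d.ht u hu)
      congr 1
      apply propext
      simp only [CrossRel, cpr, crossOrd]
      split_ifs <;> omega
  have A2 : ∀ j ∈ P.closers, (∑ q ∈ P.arcs, if CrossRel n (-j, -σ j) q then 1 else 0) =
      ∑ k ∈ P.closers, if σ j < σ k ∧ σ k < j ∧ j < k then 1 else 0 := by
    intro j hj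
    have sj := d.s hj
    rw [sum_arcs h]
    have z : (∑ k ∈ P.closers, if CrossRel n (-j, -σ j) (σ k, k) then 1 else 0) = 0 := by
      apply Finset.sum_eq_zero
      intro k hk
      have sk := d.s hk
      rw [if_neg]
      simp only [CrossRel, cpr, crossOrd]
      split_ifs <;> omega
    have z' : (∑ u ∈ V P.openers P.closers σ (n+1),
        if CrossRel n (-j, -σ j) (u, -τ u) then 1 else 0) = 0 := by
      apply Finset.sum_eq_zero
      intro u hu
      have su := d.u hu
      have tu := d.u (d.ht u hu)
      rw [if_neg]
      simp only [CrossRel, cpr, crossOrd]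
      split_ifs <;> omega
    rw [z, z', add_zero, zero_add]
    apply Finset.sum_congr rfl
    intro k hk
    have sk := d.s hk
    congr 1
    apply propext
    simp only [CrossRel, cpr, crossOrd]
    split_ifs <;> omega
  have A3 : ∀ u ∈ V P.openers P.closers σ (n+1),
      (∑ q ∈ P.arcs, if CrossRel n (u, -τ u) q then 1 else 0) =
      (∑ j ∈ P.closers, if σ j < τ u ∧ τ u < j then 1 else 0) +
      ∑ v ∈ V P.openers P.closers σ (n+1), if u < v ∧ τ u < τ v then 1 else 0 := by
    intro u hu
    have su := d.u hu
    have tu := d.u (d.ht u hu)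
    rw [sum_arcs h]
    have z : (∑ k ∈ P.closers, if CrossRel n (u, -τ u) (σ k, k) then 1 else 0) = 0 := by
      apply Finset.sum_eq_zero
      intro k hk
      have sk := d.s hk
      rw [if_neg]
      simp only [CrossRel, cpr, crossOrd]
      split_ifs <;> omega
    rw [z, zero_add]
    congr 1
    · apply Finset.sum_congr rfl
      intro k hk
      have sk := d.s hk
      congr 1
      apply propext
      simp only [CrossRel, cpr, crossOrd]
      split_ifs <;> omega
    · apply Finset.sum_congr rfl
      intro v hv
      have sv := d.u hv
      have tv := d.u (d.ht v hv)
      congr 1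
      apply propext
      simp only [CrossRel, cpr, crossOrd]
      split_ifs <;> omega
  rw [Finset.sum_congr rfl A1, Finset.sum_congr rfl A2, Finset.sum_congr rfl A3,
    Finset.sum_add_distrib,
    d.reidx (fun t => ∑ j ∈ P.closers, if σ j < t ∧ t < j then 1 else 0), Finset.sum_comm (s := V P.openers P.closers σ (n+1)) (t := P.closers)]
  unfold ab XX
  rw [Finset.sum_add_distrib]
  ring

theorem nest_eq {P : SetPartitionC n} (h : Enc P σ τ) :
    P.nestings = 2 * ∑ j ∈ P.closers, be n P.openers P.closers σ j +
      XX (V P.openers P.closers σ (n+1)) τ := by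
  have d := h.1
  unfold SetPartitionC.nestings
  rw [dbl h (NestRel n), sum_arcs h]
  have A1 : ∀ j ∈ P.closers, (∑ q ∈ P.arcs, if NestRel n (σ j, j) q then 1 else 0) =
      ∑ k ∈ P.closers, if σ j < σ k ∧ σ j < k ∧ k < j then 1 else 0 := by
    intro j hj
    have sj := d.s hj
    rw [sum_arcs h]
    have z : (∑ k ∈ P.closers, if NestRel n (σ j, j) (-k, -σ k) then 1 else 0) = 0 := by
      apply Finset.sum_eq_zero
      intro k hk
      have sk := d.s hk
      rw [if_neg]
      simp only [NestRel, nestOrd]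
      split_ifs <;> omega
    have z' : (∑ u ∈ V P.openers P.closers σ (n+1),
        if NestRel n (σ j, j) (u, -τ u) then 1 else 0) = 0 := by
      apply Finset.sum_eq_zero
      intro u hu
      have su := d.u hu
      have tu := d.u (d.ht u hu)
      rw [if_neg]
      simp only [NestRel, nestOrd]
      split_ifs <;> omega
    rw [z, z', add_zero, add_zero]
    apply Finset.sum_congr rfl
    intro k hk
    have sk := d.s hk
    congr 1
    apply propext
    simp only [NestRel, nestOrd]
    split_ifs <;> omega
  have A2 : ∀ j ∈ P.closers, (∑ q ∈ P.arcs, if NestRel n (-j, -σ j) q then 1 else 0) =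
      ∑ k ∈ P.closers, if σ j < σ k ∧ σ j < k ∧ k < j then 1 else 0 := by
    intro j hj
    have sj := d.s hj
    rw [sum_arcs h]
    have z : (∑ k ∈ P.closers, if NestRel n (-j, -σ j) (σ k, k) then 1 else 0) = 0 := by
      apply Finset.sum_eq_zero
      intro k hk
      have sk := d.s hk
      rw [if_neg]
      simp only [NestRel, nestOrd]
      split_ifs <;> omega
    have z' : (∑ u ∈ V P.openers P.closers σ (n+1),
        if NestRel n (-j, -σ j) (u, -τ u) then 1 else 0) = 0 := by
      apply Finset.sum_eq_zero
      intro u hu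
      have su := d.u hu
      have tu := d.u (d.ht u hu)
      rw [if_neg]
      simp only [NestRel, nestOrd]
      split_ifs <;> omega
    rw [z, z', add_zero, zero_add]
    apply Finset.sum_congr rfl
    intro k hk
    have sk := d.s hk
    congr 1
    apply propext
    simp only [NestRel, nestOrd]
    split_ifs <;> omega
  have A3 : ∀ u ∈ V P.openers P.closers σ (n+1),
      (∑ q ∈ P.arcs, if NestRel n (u, -τ u) q then 1 else 0) =
      (∑ j ∈ P.closers, if u < σ j ∧ u < j then 1 else 0) +
      (∑ j ∈ P.closers, if τ u < σ j ∧ τ u < j then 1 else 0) +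
      ∑ v ∈ V P.openers P.closers σ (n+1), if u < v ∧ τ u < τ v then 1 else 0 := by
    intro u hu
    have su := d.u hu
    have tu := d.u (d.ht u hu)
    rw [sum_arcs h]
    congr 1
    · congr 1
      · apply Finset.sum_congr rfl
        intro k hk
        have sk := d.s hk
        congr 1
        apply propext
        simp only [NestRel, nestOrd]
        split_ifs <;> omega
      · apply Finset.sum_congr rfl
        intro k hk
        have sk := d.s hk
        congr 1
        apply propext
        simp only [NestRel, nestOrd]
        split_ifs <;> omega
    · apply Finset.sum_congr rfl
      intro v hv
      have sv := d.u hv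
      have tv := d.u (d.ht v hv)
      congr 1
      apply propext
      simp only [NestRel, nestOrd]
      split_ifs <;> omega
  rw [Finset.sum_congr rfl A1, Finset.sum_congr rfl A2, Finset.sum_congr rfl A3,
    Finset.sum_add_distrib, Finset.sum_add_distrib,
    d.reidx (fun t => ∑ j ∈ P.closers, if t < σ j ∧ t < j then 1 else 0)]
  unfold be XX
  rw [Finset.sum_add_distrib,
    Finset.sum_comm (s := P.closers) (t := V P.openers P.closers σ (n+1)),
    Finset.sum_comm (s := P.closers) (t := P.closers)]
  ring

/-! ### Part E: the bijection -/

def Rel (P Q : SetPartitionC n) : Prop :=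
  Q.openers = P.openers ∧ Q.closers = P.closers ∧ ∃ σ τ σ' τ', Enc P σ τ ∧ Enc Q σ' τ' ∧
    Link n P.openers P.closers σ τ σ' τ'

theorem Rel.symm {P Q : SetPartitionC n} (h : Rel P Q) : Rel Q P := by
  obtain ⟨ho, hc, σ, τ, σ', τ', e, e', l⟩ := h
  refine ⟨ho.symm, hc.symm, σ', τ', σ, τ, e', e, ?_⟩
  have d := e.1
  have d' := e'.1
  rw [ho, hc] at d' ⊢
  exact l.symm d d'

theorem Rel.ex (P : SetPartitionC n) : ∃ Q, Rel P Q := by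
  obtain ⟨σ, τ, e⟩ := extract P
  obtain ⟨σ', τ', d', l⟩ := ex_link e.1
  obtain ⟨Q, ho, hc, e'⟩ := realize d'
  exact ⟨Q, ho, hc, σ, τ, σ', τ', e, e', l⟩

theorem Rel.uniq {P Q Q' : SetPartitionC n} (h : Rel P Q) (h' : Rel P Q') : Q = Q' := by
  obtain ⟨ho, hc, σ, τ, σ₁, τ₁, e, e₁, l⟩ := h
  obtain ⟨ho', hc', s, t, σ₂, τ₂, e', e₂, l'⟩ := h'
  obtain ⟨rfl, rfl⟩ := e.uniq e'
  have d₁ := e₁.1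
  have d₂ := e₂.1
  rw [ho, hc] at d₁
  rw [ho', hc'] at d₂
  obtain ⟨rfl, rfl⟩ := link_uniq e.1 d₁ d₂ l l'
  apply ext_arc
  intro i j
  rw [e₁.2, e₂.2, ho, hc, ho', hc']

theorem Rel.cr {P Q : SetPartitionC n} (h : Rel P Q) : Q.crossings = P.nestings := by
  obtain ⟨ho, hc, σ, τ, σ', τ', e, e', l⟩ := h
  rw [cross_eq e', nest_eq e]
  have d := e.1
  have d' := e'.1
  rw [ho, hc] at d' ⊢
  rw [link_XX d d' l]
  congr 2
  apply Finset.sum_congr rfl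
  intro j hj
  have h1 := d'.ab_eq hj
  have h2 := d.be_eq hj
  have h3 := l.l1 j hj
  have h4 := d.card_eq d' j
  omega

end

end X4

theorem stmt4 (n : ℕ) (hn : 0 < n) :
    ∃ Φ : SetPartitionC n → SetPartitionC n, Function.Bijective Φ ∧
      ∀ P : SetPartitionC n,
        (Φ P).openers = P.openers ∧ (Φ P).closers = P.closers ∧
        (Φ P).crossings = P.nestings ∧ (Φ P).nestings = P.crossings := by
  choose Φ hΦ using (fun P : SetPartitionC n => X4.Rel.ex P)
  have inv : Function.Involutive Φ := fun P => X4.Rel.uniq (hΦ (Φ P)) (hΦ P).symm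
  exact ⟨Φ, inv.bijective, fun P => ⟨(hΦ P).1, (hΦ P).2.1, (hΦ P).cr, ((hΦ P).symm.cr).symm⟩⟩
end
end
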